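/- arXiv:1601.00717 — 4 statements merged into one kernel-verified Lean document; each statement's English description precedes it below -/
import Mathlib

section
/- Lyapunov drift for the time-h semigroup: there exists α₁ ∈ (1/4, 1/2) such that for every α ∈ (α₁, 1/2) there exists h₁ > 0 such that for every h ∈ (0, h₁) there are constants c₀ > 0 and M > 0 (depending on α and h) with the following property: setting V = V_α and β = 1 − 1/(4α), one has (P^h V)(x) − V(x) ≤ −c₀ V(x)^β for every x ∈ Δ with V(x) > M. -/
open MeasureTheory Set Filter

noncomputable section

/-- The open set `U ⊂ ℝ^m` with which the open simplex `Δ` is identified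
(via `y = Ē - ∑ i, x i`). -/
def simU (m : ℕ) (E : ℝ) : Set (Fin m → ℝ) := {x | (∀ i, 0 < x i) ∧ ∑ i, x i < E}

/-- The state space `Δ`. -/
abbrev Delta (m : ℕ) (E : ℝ) : Type := ↥(simU m E)

/-- The tank energy `y = Ē - ∑ i, x i`. -/
def tank (m : ℕ) (E : ℝ) (x : Delta m E) : ℝ := E - ∑ i, x.1 i

/-- The energy exchange map on the ambient space: particle `i` gets energy
`y + (1-u²) x^i`, and the new tank energy is `u² x^i`. -/
def T0 (m : ℕ) (E : ℝ) (i : Fin m) (u : ℝ) (x : Fin m → ℝ) : Fin m → ℝ :=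
  Function.update x i ((E - ∑ j, x j) + (1 - u ^ 2) * x i)

lemma T0_mem {m : ℕ} {E : ℝ} {i : Fin m} {u : ℝ} {x : Fin m → ℝ}
    (hx : x ∈ simU m E) (hu : u ∈ Ioo (0:ℝ) 1) : T0 m E i u x ∈ simU m E := by
  obtain ⟨hpos, hsum⟩ := hx
  obtain ⟨hu0, hu1⟩ := hu
  have hy : 0 < E - ∑ j, x j := sub_pos.mpr hsum
  have hu2 : 0 < 1 - u ^ 2 := by nlinarith
  have hxi := hpos i
  constructor
  · intro j
    rcases eq_or_ne j i with rfl | hj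
    · simp only [T0, Function.update_self]
      nlinarith
    · simpa [T0, Function.update_of_ne hj] using hpos j
  · have h1 : ∑ j, T0 m E i u x j
        = ((E - ∑ j, x j) + (1 - u ^ 2) * x i) + ∑ j ∈ Finset.univ \ {i}, x j := by
      simp only [T0]
      rw [Finset.sum_update_of_mem (Finset.mem_univ i)]
    have h2 : ∑ j ∈ Finset.univ \ {i}, x j = (∑ j, x j) - x i := by
      rw [← Finset.erase_eq]
      exact Finset.sum_erase_eq_sub (Finset.mem_univ i)
    rw [h1, h2]
    nlinarith [mul_pos (mul_pos hu0 hu0) hxi]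

/-- The energy exchange map `T_{i,u} : Δ → Δ` (defined to be the identity for
`u ∉ (0,1)`, which is a probability-zero event). -/
def Texch (m : ℕ) (E : ℝ) (i : Fin m) (u : ℝ) (x : Delta m E) : Delta m E :=
  if hu : u ∈ Ioo (0:ℝ) 1 then ⟨T0 m E i u x.1, T0_mem x.2 hu⟩ else x

/-- The uniform distribution on `(0,1)`. -/
def unif01 : Measure ℝ := volume.restrict (Ioo (0:ℝ) 1)

/-- The uniformization constant `Λ = √(m Ē)`, an upper bound for the total jump rate. -/
def Lam (m : ℕ) (E : ℝ) : ℝ := Real.sqrt (m * E)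

/-- The total jump rate `∑ i, √(x^i)`. -/
def jumpRate (m : ℕ) (E : ℝ) (x : Delta m E) : ℝ := ∑ i, Real.sqrt (x.1 i)

/-- One step of the uniformized embedded chain: with probability `1 - r(x)/Λ` stay put,
and with probability `√(x^i)/Λ` particle `i` exchanges energy with the tank, with
`u` drawn uniformly from `(0,1)`. -/
def ustep (m : ℕ) (E : ℝ) (x : Delta m E) : Measure (Delta m E) :=
  ENNReal.ofReal (1 - jumpRate m E x / Lam m E) • Measure.dirac x
  + (ENNReal.ofReal (Lam m E))⁻¹ •
      Measure.sum (fun i : Fin m =>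
        ENNReal.ofReal (Real.sqrt (x.1 i)) • Measure.map (fun u => Texch m E i u x) unif01)

/-- `n`-fold iterate of the uniformized chain. -/
def ustepIter (m : ℕ) (E : ℝ) : ℕ → Delta m E → Measure (Delta m E)
  | 0 => fun x => Measure.dirac x
  | (n+1) => fun x => (ustep m E x).bind (ustepIter m E n)

/-- The transition probabilities `P^t(x, ·)` of the energy-exchange jump process,
constructed by uniformization: `P^t = ∑ₙ e^{-Λt} (Λt)ⁿ/n! Kⁿ`. -/
def Pt (m : ℕ) (E : ℝ) (t : ℝ) (x : Delta m E) : Measure (Delta m E) :=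
  Measure.sum (fun n : ℕ =>
    ENNReal.ofReal (Real.exp (-(Lam m E) * t) * ((Lam m E) * t) ^ n / n.factorial) •
      ustepIter m E n x)

/-- Lebesgue measure on `Δ ≅ U`. -/
def lebU (m : ℕ) (E : ℝ) : Measure (Delta m E) := Measure.comap Subtype.val volume

/-- The (unnormalized) measure with density `y^{-1/2}` w.r.t. Lebesgue measure on `U`. -/
def piPre (m : ℕ) (E : ℝ) : Measure (Delta m E) :=
  (lebU m E).withDensity (fun x => ENNReal.ofReal ((tank m E x) ^ (-(1/2) : ℝ)))

/-- The invariant probability measure `π`, with density `Z⁻¹ y^{-1/2}`. -/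
def piMeasure (m : ℕ) (E : ℝ) : Measure (Delta m E) :=
  (piPre m E Set.univ)⁻¹ • piPre m E

/-- Total variation distance between two (finite) measures:
`sup_A |μ(A) - ν(A)|`. -/
def tvDist {X : Type*} [MeasurableSpace X] (μ ν : Measure X) : ℝ :=
  ⨆ A : {A : Set X // MeasurableSet A}, |(μ A.1).toReal - (ν A.1).toReal|

end

/-- The Lyapunov function `V_α(x) = ∑ i, (x^i)^{-2α} + y^{-α}`. -/
noncomputable def Vfun (m : ℕ) (E : ℝ) (α : ℝ) (x : Delta m E) : ℝ :=
  ∑ i, (x.1 i) ^ (-(2 * α)) + (tank m E x) ^ (-α)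


lemma aux_young (a b p q : ℝ) (ha : 0 < a) (hb : 0 < b) (hp : 0 < p) (hpq : p < q) :
    ∃ C : ℝ, 0 ≤ C ∧ ∀ y : ℝ, 0 < y → a * y ^ (-p) ≤ b * y ^ (-q) + C := by
  set y0 : ℝ := (b / a) ^ (1 / (q - p)) with hy0
  have hy0p : 0 < y0 := by positivity
  refine ⟨a * y0 ^ (-p), by positivity, fun y hy => ?_⟩
  rcases le_total y y0 with h | h
  · have h1 : y ^ (-p) = y ^ (-q) * y ^ (q - p) := by
      rw [← Real.rpow_add hy]; ring_nf
    have h2 : y ^ (q - p) ≤ b / a := by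
      calc y ^ (q - p) ≤ y0 ^ (q - p) := Real.rpow_le_rpow hy.le h (by linarith)
        _ = b / a := by
          rw [hy0, ← Real.rpow_mul (by positivity), one_div_mul_cancel (by linarith), Real.rpow_one]
    have h3 : a * y ^ (q - p) ≤ b := by
      rw [le_div_iff₀ ha] at h2; linarith
    have h4 : 0 < y ^ (-q) := by positivity
    have h5 : 0 < a * y0 ^ (-p) := by positivity
    rw [h1]; nlinarith
  · have h1 : y ^ (-p) ≤ y0 ^ (-p) := Real.rpow_le_rpow_of_nonpos hy0p h (by linarith)
    have h4 : 0 < b * y ^ (-q) := by positivity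
    nlinarith

lemma aux_rpow_le_one_add (t β : ℝ) (ht : 0 < t) (h0 : 0 ≤ β) (h1 : β ≤ 1) : t ^ β ≤ t + 1 := by
  rcases le_total t 1 with h | h
  · have := Real.rpow_le_one ht.le h h0
    linarith
  · have := Real.rpow_le_rpow_of_exponent_le h h1
    rw [Real.rpow_one] at this
    linarith

lemma aux_sum_rpow {ι : Type*} (s : Finset ι) (f : ι → ℝ) (hf : ∀ i, 0 < f i) (b β : ℝ)
    (hb : 0 < b) (h0 : 0 < β) (h1 : β ≤ 1) :
    (∑ i ∈ s, f i + b) ^ β ≤ ∑ i ∈ s, f i ^ β + b ^ β := by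
  classical
  induction s using Finset.induction_on with
  | empty => simp
  | insert i s hi ih =>
    rw [Finset.sum_insert hi, Finset.sum_insert hi, add_assoc, add_assoc]
    have h2 : 0 ≤ ∑ i ∈ s, f i + b := by
      have := Finset.sum_nonneg (s := s) (fun i _ => (hf i).le)
      linarith
    have := Real.rpow_add_le_add_rpow (hf i).le h2 h0.le h1
    linarith

/-- per-particle inequality -/
lemma aux_particle (α : ℝ) (h1 : 1/4 < α) (h2 : α < 1/2) (E x y : ℝ) (hx : 0 < x) (hy : 0 < y)
    (hxE : x ≤ E) :
    Real.sqrt x * (min (y ^ (-(2*α))) (1/(1-2*α) * x ^ (-(2*α))) - x ^ (-(2*α))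
       + 1/(1-2*α) * x ^ (-α))
      ≤ -(1/2) * x ^ (1/2 - 2*α) + 2 * (1/(1-2*α)) * y ^ (-(2*α - 1/2))
        + 1/(1-2*α) * E ^ (1/2-α) := by
  set B : ℝ := 1/(1-2*α) with hB
  have hBp : 0 < B := by rw [hB]; apply one_div_pos.mpr; linarith
  have e1 : Real.sqrt x * x ^ (-(2*α)) = x ^ (1/2 - 2*α) := by
    rw [Real.sqrt_eq_rpow, ← Real.rpow_add hx]; ring_nf
  have e2 : Real.sqrt x * x ^ (-α) = x ^ (1/2 - α) := by
    rw [Real.sqrt_eq_rpow, ← Real.rpow_add hx]; ring_nf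
  have e3 : x ^ (1/2 - α) ≤ E ^ (1/2-α) := Real.rpow_le_rpow hx.le hxE (by linarith)
  have hs : 0 < Real.sqrt x := Real.sqrt_pos.mpr hx
  have hp : 0 < x ^ (1/2 - 2*α) := by positivity
  have hq : 0 < y ^ (-(2*α - 1/2)) := by positivity
  have e4 : B * x ^ (1/2 - α) ≤ B * E ^ (1/2-α) := by gcongr
  have four : (4:ℝ) ^ (1/2:ℝ) = 2 := by
    rw [← Real.sqrt_eq_rpow, show (4:ℝ) = 2^2 by norm_num]; simp
  suffices h : Real.sqrt x * min (y ^ (-(2*α))) (B * x ^ (-(2*α)))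
      ≤ (1/2) * x ^ (1/2 - 2*α) + 2 * B * y ^ (-(2*α - 1/2)) by
    have : Real.sqrt x * (min (y ^ (-(2*α))) (B * x ^ (-(2*α))) - x ^ (-(2*α))
       + B * x ^ (-α)) = Real.sqrt x * min (y ^ (-(2*α))) (B * x ^ (-(2*α)))
         - Real.sqrt x * x ^ (-(2*α)) + B * (Real.sqrt x * x ^ (-α)) := by ring
    rw [this, e1, e2]; linarith
  rcases le_total (4*x) y with h | h
  · have a1 : y ^ (-(2*α)) ≤ (1/2) * x ^ (-(2*α)) := by
      calc y ^ (-(2*α)) ≤ (4*x) ^ (-(2*α)) :=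
            Real.rpow_le_rpow_of_nonpos (by positivity) h (by linarith)
        _ = 4 ^ (-(2*α)) * x ^ (-(2*α)) := Real.mul_rpow (by norm_num) hx.le
        _ ≤ (1/2) * x ^ (-(2*α)) := by
          gcongr
          calc (4:ℝ) ^ (-(2*α)) ≤ 4 ^ (-(1/2:ℝ)) :=
                Real.rpow_le_rpow_of_exponent_le (by norm_num) (by linarith)
            _ = 1/2 := by rw [Real.rpow_neg (by norm_num), four]; norm_num
    calc _ ≤ Real.sqrt x * ((1/2) * x ^ (-(2*α))) := by
            gcongr; exact (min_le_left _ _).trans a1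
      _ = (1/2) * x ^ (1/2 - 2*α) := by rw [← e1]; ring
      _ ≤ _ := by have : 0 < 2 * B * y ^ (-(2*α - 1/2)) := by positivity
                  linarith
  · have a1 : x ^ (1/2 - 2*α) ≤ 2 * y ^ (-(2*α - 1/2)) := by
      calc x ^ (1/2 - 2*α) ≤ ((1/4) * y) ^ (1/2 - 2*α) :=
            Real.rpow_le_rpow_of_nonpos (by positivity) (by linarith) (by linarith)
        _ = (1/4) ^ (1/2 - 2*α) * y ^ (1/2 - 2*α) := Real.mul_rpow (by norm_num) hy.le
        _ ≤ 2 * y ^ (1/2 - 2*α) := by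
          gcongr
          rw [one_div, Real.inv_rpow (by norm_num), ← Real.rpow_neg (by norm_num), ← four]
          exact Real.rpow_le_rpow_of_exponent_le (by norm_num) (by linarith)
        _ = _ := by ring_nf
    calc _ ≤ Real.sqrt x * (B * x ^ (-(2*α))) := by
            gcongr; exact min_le_right _ _
      _ = B * x ^ (1/2 - 2*α) := by rw [← e1]; ring
      _ ≤ B * (2 * y ^ (-(2*α - 1/2))) := by gcongr
      _ ≤ _ := by linarith

/-- generator bound -/
lemma aux_gen (m : ℕ) (hm : 1 ≤ m) (E : ℝ) (hE : 0 < E) (α : ℝ) (h1 : 1/4 < α) (h2 : α < 1/2) :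
    ∃ c > (0:ℝ), ∃ C : ℝ, 0 ≤ C ∧ ∀ (x : Fin m → ℝ) (y : ℝ), (∀ i, 0 < x i) → 0 < y →
      y = E - ∑ i, x i →
      ∑ i, Real.sqrt (x i) * (min (y ^ (-(2*α))) (1/(1-2*α) * (x i) ^ (-(2*α)))
          - (x i) ^ (-(2*α)) + 1/(1-2*α) * (x i) ^ (-α) - y ^ (-α))
        ≤ C - c * (∑ i, (x i) ^ (-(2*α)) + y ^ (-α)) ^ (1 - 1/(4*α)) := by
  set B : ℝ := 1/(1-2*α) with hB
  have hBp : 0 < B := by rw [hB]; apply one_div_pos.mpr; linarith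
  have hmp : (0:ℝ) < m := by exact_mod_cast hm
  have hsE : 0 < Real.sqrt E := Real.sqrt_pos.mpr hE
  obtain ⟨C1, hC1, hY⟩ := aux_young (m * (2 * B)) (Real.sqrt E / 2) (2*α-1/2) α (by positivity)
    (by positivity) (by linarith) (by linarith)
  set c : ℝ := min (1/2) (Real.sqrt E / 2) with hc
  have hcp : 0 < c := lt_min (by norm_num) (by positivity)
  have hc1 : c ≤ 1/2 := min_le_left _ _
  have hc2 : c ≤ Real.sqrt E / 2 := min_le_right _ _
  refine ⟨c, hcp, C1 + m * (B * E ^ (1/2-α)) + E ^ (1-α) / Real.sqrt E + c, by positivity, ?_⟩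
  intro x y hx hy hyE
  have hsum : ∑ i, x i = E - y := by linarith
  have hxE : ∀ i, x i ≤ E := fun i => by
    have := Finset.single_le_sum (f := x) (fun j _ => (hx j).le) (Finset.mem_univ i)
    linarith
  have hyE' : y ≤ E := by
    have := Finset.sum_nonneg (s := Finset.univ) (fun i _ => (hx i).le)
    linarith
  have s1 : ∑ i, Real.sqrt (x i) * (min (y ^ (-(2*α))) (B * (x i) ^ (-(2*α)))
          - (x i) ^ (-(2*α)) + B * (x i) ^ (-α) - y ^ (-α))
      ≤ ∑ i, (-(1/2) * (x i) ^ (1/2 - 2*α) + (2 * B * y ^ (-(2*α - 1/2))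
        + B * E ^ (1/2-α)) - y ^ (-α) * Real.sqrt (x i)) := by
    apply Finset.sum_le_sum
    intro i _
    have := aux_particle α h1 h2 E (x i) y (hx i) hy (hxE i)
    rw [← hB] at this
    linarith
  rw [Finset.sum_sub_distrib, Finset.sum_add_distrib, ← Finset.mul_sum, ← Finset.mul_sum] at s1
  simp only [Finset.sum_const, Finset.card_univ, Fintype.card_fin, nsmul_eq_mul] at s1
  have s2 : (E - y) / Real.sqrt E ≤ ∑ i, Real.sqrt (x i) := by
    rw [← hsum, Finset.sum_div]
    apply Finset.sum_le_sum
    intro i _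
    rw [div_le_iff₀ hsE]
    nlinarith [Real.sqrt_le_sqrt (hxE i), Real.mul_self_sqrt (hx i).le, Real.sqrt_nonneg (x i)]
  have hya : 0 < y ^ (-α) := by positivity
  have s3 : Real.sqrt E * y ^ (-α) - E ^ (1-α) / Real.sqrt E ≤ y ^ (-α) * ∑ i, Real.sqrt (x i) := by
    calc Real.sqrt E * y ^ (-α) - E ^ (1-α) / Real.sqrt E
        ≤ Real.sqrt E * y ^ (-α) - y ^ (1-α) / Real.sqrt E := by
          gcongr; linarith
      _ = y ^ (-α) * ((E - y) / Real.sqrt E) := by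
          rw [show (1-α) = -α + 1 by ring, Real.rpow_add hy, Real.rpow_one]
          field_simp
          rw [Real.sq_sqrt hE.le]
      _ ≤ _ := by gcongr
  have s4 := hY y hy
  have hβ0 : 0 < 1 - 1/(4*α) := by
    rw [sub_pos, div_lt_one (by linarith)]; linarith
  have hβ1 : 1 - 1/(4*α) ≤ 1 := by
    have : 0 < 1/(4*α) := by apply one_div_pos.mpr; linarith
    linarith
  have s5 := aux_sum_rpow Finset.univ (fun i => (x i) ^ (-(2*α)))
    (fun i => Real.rpow_pos_of_pos (hx i) _) (y ^ (-α)) (1 - 1/(4*α)) hya hβ0 hβ1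
  have s6 : ∀ i, ((x i) ^ (-(2*α))) ^ (1 - 1/(4*α)) = (x i) ^ (1/2 - 2*α) := fun i => by
    rw [← Real.rpow_mul (hx i).le]
    congr 1
    have : α ≠ 0 := by linarith
    field_simp; ring
  simp only [s6] at s5
  have s7 := aux_rpow_le_one_add (y ^ (-α)) _ hya hβ0.le hβ1
  have s8 : 0 ≤ ∑ i, (x i) ^ (1/2 - 2*α) :=
    Finset.sum_nonneg (fun i _ => (Real.rpow_pos_of_pos (hx i) _).le)
  have s9 : c * (∑ i, (x i) ^ (-(2*α)) + y ^ (-α)) ^ (1 - 1/(4*α))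
      ≤ c * (∑ i, (x i) ^ (1/2 - 2*α) + (y ^ (-α) + 1)) := by gcongr; linarith
  nlinarith

lemma aux_int1 (α : ℝ) (h2 : α < 1/2) :
    ∫⁻ u, ENNReal.ofReal (u ^ (-(2*α))) ∂unif01 ≤ ENNReal.ofReal (1/(1-2*α)) := by
  have hi : IntervalIntegrable (fun u : ℝ => u ^ (-(2*α))) volume 0 1 :=
    intervalIntegral.intervalIntegrable_rpow' (by linarith)
  have hi2 : Integrable (fun u : ℝ => u ^ (-(2*α))) unif01 := by
    rw [intervalIntegrable_iff_integrableOn_Ioo_of_le zero_le_one] at hi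
    exact hi
  rw [← ofReal_integral_eq_lintegral_ofReal hi2]
  · apply ENNReal.ofReal_le_ofReal
    have : ∫ u, u ^ (-(2*α)) ∂unif01 = ∫ u in (0:ℝ)..1, u ^ (-(2*α)) := by
      rw [intervalIntegral.integral_of_le zero_le_one, integral_Ioc_eq_integral_Ioo]; rfl
    rw [this, integral_rpow (Or.inl (by linarith))]
    rw [Real.one_rpow, Real.zero_rpow (by linarith)]
    apply le_of_eq; ring_nf
  · filter_upwards [ae_restrict_mem measurableSet_Ioo] with u hu
    exact Real.rpow_nonneg hu.1.le _

lemma aux_int2 (α : ℝ) (h2 : α < 1/2) :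
    ∫⁻ u, ENNReal.ofReal ((1-u) ^ (-(2*α))) ∂unif01 ≤ ENNReal.ofReal (1/(1-2*α)) := by
  have hi0 : IntervalIntegrable (fun u : ℝ => u ^ (-(2*α))) volume 1 0 :=
    (intervalIntegral.intervalIntegrable_rpow' (by linarith))
  have hi : IntervalIntegrable (fun u : ℝ => (1-u) ^ (-(2*α))) volume 0 1 := by
    simpa using hi0.comp_sub_left 1
  have hi2 : Integrable (fun u : ℝ => (1-u) ^ (-(2*α))) unif01 := by
    rw [intervalIntegrable_iff_integrableOn_Ioo_of_le zero_le_one] at hi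
    exact hi
  rw [← ofReal_integral_eq_lintegral_ofReal hi2]
  · apply ENNReal.ofReal_le_ofReal
    have : ∫ u, (1-u) ^ (-(2*α)) ∂unif01 = ∫ u in (0:ℝ)..1, (1-u) ^ (-(2*α)) := by
      rw [intervalIntegral.integral_of_le zero_le_one, integral_Ioc_eq_integral_Ioo]; rfl
    rw [this, intervalIntegral.integral_comp_sub_left (fun u => u ^ (-(2*α))) 1]
    rw [sub_self, sub_zero, integral_rpow (Or.inl (by linarith))]
    rw [Real.one_rpow, Real.zero_rpow (by linarith)]
    apply le_of_eq; ring_nf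
  · filter_upwards [ae_restrict_mem measurableSet_Ioo] with u hu
    exact Real.rpow_nonneg (by linarith [hu.2]) _

lemma aux_unif_univ : unif01 univ = 1 := by
  simp [unif01]

lemma aux_int3 (α : ℝ) (h1 : 1/4 < α) (h2 : α < 1/2) (x y : ℝ) (hx : 0 < x) (hy : 0 < y) :
    ∫⁻ u, ENNReal.ofReal ((y + (1-u^2)*x) ^ (-(2*α))) ∂unif01
      ≤ ENNReal.ofReal (min (y ^ (-(2*α))) (1/(1-2*α) * x ^ (-(2*α)))) := by
  rcases min_choice (y ^ (-(2*α))) (1/(1-2*α) * x ^ (-(2*α))) with h | h <;> rw [h]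
  · calc _ ≤ ∫⁻ u, ENNReal.ofReal (y ^ (-(2*α))) ∂unif01 := by
          apply lintegral_mono_ae
          filter_upwards [ae_restrict_mem measurableSet_Ioo] with u hu
          apply ENNReal.ofReal_le_ofReal
          apply Real.rpow_le_rpow_of_nonpos hy _ (by linarith)
          have : 0 ≤ 1 - u^2 := by nlinarith [hu.1, hu.2]
          nlinarith
      _ = _ := by rw [lintegral_const, aux_unif_univ, mul_one]
  · calc _ ≤ ∫⁻ u, ENNReal.ofReal (x ^ (-(2*α))) * ENNReal.ofReal ((1-u) ^ (-(2*α))) ∂unif01 := by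
          apply lintegral_mono_ae
          filter_upwards [ae_restrict_mem measurableSet_Ioo] with u hu
          have hu1 : 0 < 1 - u := by linarith [hu.2]
          rw [← ENNReal.ofReal_mul (by positivity), ← Real.mul_rpow hx.le hu1.le]
          apply ENNReal.ofReal_le_ofReal
          apply Real.rpow_le_rpow_of_nonpos (by positivity) _ (by linarith)
          have : 1 - u ≤ 1 - u^2 := by nlinarith [hu.1, hu.2]
          nlinarith
      _ = ENNReal.ofReal (x ^ (-(2*α))) * ∫⁻ u, ENNReal.ofReal ((1-u) ^ (-(2*α))) ∂unif01 := by
          rw [lintegral_const_mul' _ _ ENNReal.ofReal_ne_top]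
      _ ≤ ENNReal.ofReal (x ^ (-(2*α))) * ENNReal.ofReal (1/(1-2*α)) := by
          gcongr; exact aux_int2 α h2
      _ = _ := by rw [← ENNReal.ofReal_mul (by positivity), mul_comm]

lemma aux_int4 (α : ℝ) (h2 : α < 1/2) (x : ℝ) (hx : 0 < x) :
    ∫⁻ u, ENNReal.ofReal ((u^2*x) ^ (-α)) ∂unif01
      ≤ ENNReal.ofReal (1/(1-2*α) * x ^ (-α)) := by
  calc _ ≤ ∫⁻ u, ENNReal.ofReal (x ^ (-α)) * ENNReal.ofReal (u ^ (-(2*α))) ∂unif01 := by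
          apply lintegral_mono_ae
          filter_upwards [ae_restrict_mem measurableSet_Ioo] with u hu
          have hu1 : 0 < u := hu.1
          rw [← ENNReal.ofReal_mul (by positivity)]
          apply ENNReal.ofReal_le_ofReal
          rw [Real.mul_rpow (by positivity) hx.le, mul_comm, ← Real.rpow_natCast,
            ← Real.rpow_mul hu1.le]
          apply le_of_eq; push_cast; ring_nf
      _ = ENNReal.ofReal (x ^ (-α)) * ∫⁻ u, ENNReal.ofReal (u ^ (-(2*α))) ∂unif01 := by
          rw [lintegral_const_mul' _ _ ENNReal.ofReal_ne_top]
      _ ≤ ENNReal.ofReal (x ^ (-α)) * ENNReal.ofReal (1/(1-2*α)) := by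
          gcongr; exact aux_int1 α h2
      _ = _ := by rw [← ENNReal.ofReal_mul (by positivity), mul_comm]

lemma aux_V_Texch (m : ℕ) (E α : ℝ) (i : Fin m) (u : ℝ) (hu : u ∈ Ioo (0:ℝ) 1) (x : Delta m E) :
    Vfun m E α (Texch m E i u x) = (∑ j ∈ Finset.univ.erase i, (x.1 j) ^ (-(2*α)))
      + (tank m E x + (1-u^2) * x.1 i) ^ (-(2*α)) + (u^2 * x.1 i) ^ (-α) := by
  have hT : (Texch m E i u x).1 = T0 m E i u x.1 := by simp only [Texch, dif_pos hu]
  have key : ∀ g : ℝ → ℝ, ∑ j, g (T0 m E i u x.1 j) = g (tank m E x + (1-u^2) * x.1 i)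
      + ∑ j ∈ Finset.univ.erase i, g (x.1 j) := by
    intro g
    rw [← Finset.add_sum_erase _ _ (Finset.mem_univ i)]
    congr 1
    · simp [T0, tank]
    · apply Finset.sum_congr rfl
      intro j hj
      rw [T0, Function.update_of_ne (Finset.ne_of_mem_erase hj)]
  have htank : tank m E (Texch m E i u x) = u^2 * x.1 i := by
    have k := key id
    simp only [id] at k
    have k2 := Finset.add_sum_erase Finset.univ x.1 (Finset.mem_univ i)
    rw [tank, hT, k]
    have k3 : tank m E x = E - ∑ j, x.1 j := rfl
    rw [k3]; linarith
  rw [Vfun, htank, hT, key (fun t => t ^ (-(2*α)))]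
  ring

lemma aux_tank_pos {m : ℕ} {E : ℝ} (x : Delta m E) : 0 < tank m E x := sub_pos.mpr x.2.2

lemma aux_V_split (m : ℕ) (E α : ℝ) (i : Fin m) (x : Delta m E) :
    ∑ j ∈ Finset.univ.erase i, (x.1 j) ^ (-(2*α))
      = Vfun m E α x - (x.1 i) ^ (-(2*α)) - (tank m E x) ^ (-α) := by
  have := Finset.add_sum_erase Finset.univ (fun j => (x.1 j) ^ (-(2*α))) (Finset.mem_univ i)
  rw [Vfun]; linarith

lemma aux_jump (m : ℕ) (E α : ℝ) (h1 : 1/4 < α) (h2 : α < 1/2) (i : Fin m) (x : Delta m E) :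
    ∫⁻ u, ENNReal.ofReal (Vfun m E α (Texch m E i u x)) ∂unif01 ≤
      ENNReal.ofReal (Vfun m E α x + (min ((tank m E x) ^ (-(2*α)))
        (1/(1-2*α) * (x.1 i) ^ (-(2*α))) - (x.1 i) ^ (-(2*α)) + 1/(1-2*α) * (x.1 i) ^ (-α)
        - (tank m E x) ^ (-α))) := by
  have hx := x.2.1 i
  have hy := aux_tank_pos x
  have hB : 0 < 1/(1-2*α) := by apply one_div_pos.mpr; linarith
  set S := ∑ j ∈ Finset.univ.erase i, (x.1 j) ^ (-(2*α)) with hS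
  have hS0 : 0 ≤ S := Finset.sum_nonneg (fun j _ => (Real.rpow_pos_of_pos (x.2.1 j) _).le)
  calc _ ≤ ∫⁻ u, ((ENNReal.ofReal S + ENNReal.ofReal ((tank m E x + (1-u^2) * x.1 i) ^ (-(2*α))))
        + ENNReal.ofReal ((u^2 * x.1 i) ^ (-α))) ∂unif01 := by
        apply lintegral_mono_ae
        filter_upwards [ae_restrict_mem measurableSet_Ioo] with u hu
        rw [aux_V_Texch m E α i u hu x]
        exact ENNReal.ofReal_add_le.trans (add_le_add_left ENNReal.ofReal_add_le _)
    _ = ENNReal.ofReal S + ∫⁻ u, ENNReal.ofReal ((tank m E x + (1-u^2) * x.1 i) ^ (-(2*α))) ∂unif01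
        + ∫⁻ u, ENNReal.ofReal ((u^2 * x.1 i) ^ (-α)) ∂unif01 := by
        rw [lintegral_add_right _ (by fun_prop), lintegral_add_left (by fun_prop), lintegral_const,
          aux_unif_univ, mul_one]
    _ ≤ ENNReal.ofReal S + ENNReal.ofReal (min ((tank m E x) ^ (-(2*α)))
        (1/(1-2*α) * (x.1 i) ^ (-(2*α)))) + ENNReal.ofReal (1/(1-2*α) * (x.1 i) ^ (-α)) := by
        gcongr
        · exact aux_int3 α h1 h2 _ _ hx hy
        · exact aux_int4 α h2 _ hx
    _ = _ := by
        rw [← ENNReal.ofReal_add hS0 (by positivity), ← ENNReal.ofReal_add (by positivity)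
          (by positivity)]
        congr 1
        rw [hS, aux_V_split]; ring

lemma aux_Lam_pos (m : ℕ) (hm : 1 ≤ m) (E : ℝ) (hE : 0 < E) : 0 < Lam m E := by
  have hmp : (0:ℝ) < m := by exact_mod_cast hm
  exact Real.sqrt_pos.mpr (by positivity)

lemma aux_rate_le (m : ℕ) (E : ℝ) (x : Delta m E) : jumpRate m E x ≤ Lam m E := by
  apply Real.le_sqrt_of_sq_le
  have := sq_sum_le_card_mul_sum_sq (s := Finset.univ) (f := fun i => Real.sqrt (x.1 i))
  simp only [Finset.card_univ, Fintype.card_fin] at this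
  have h2 : ∑ i, Real.sqrt (x.1 i) ^ 2 = ∑ i, x.1 i :=
    Finset.sum_congr rfl (fun i _ => Real.sq_sqrt (x.2.1 i).le)
  rw [h2] at this
  refine this.trans ?_
  gcongr
  exact x.2.2.le

lemma aux_V_pos (m : ℕ) (E α : ℝ) (x : Delta m E) : 0 < Vfun m E α x := by
  have : 0 ≤ ∑ j, (x.1 j) ^ (-(2*α)) :=
    Finset.sum_nonneg (fun j _ => (Real.rpow_pos_of_pos (x.2.1 j) _).le)
  have := Real.rpow_pos_of_pos (aux_tank_pos x) (-α)
  rw [Vfun]; linarith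

lemma aux_V_meas (m : ℕ) (E α : ℝ) : Measurable (Vfun m E α) := by
  have hc : ∀ i, Measurable (fun x : Delta m E => x.1 i) := fun i =>
    (measurable_pi_apply i).comp measurable_subtype_coe
  have hS : Measurable (fun x : Delta m E => ∑ i, x.1 i) :=
    Finset.measurable_fun_sum _ (fun i _ => hc i)
  have h1 : Measurable (fun x : Delta m E => ∑ i, (x.1 i) ^ (-(2*α))) :=
    Finset.measurable_fun_sum _ (fun i _ => (hc i).pow_const _)
  exact h1.add ((measurable_const.sub hS).pow_const _)

/-- general upper bound for integrals against one step -/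
lemma aux_ustep_le (m : ℕ) (hm : 1 ≤ m) (E : ℝ) (hE : 0 < E) (x : Delta m E)
    (f : Delta m E → ℝ) (hf : 0 ≤ f x) (hfm : Measurable f) (d : Fin m → ℝ)
    (hd : ∀ i, 0 ≤ f x + d i)
    (hj : ∀ i, ∫⁻ u, ENNReal.ofReal (f (Texch m E i u x)) ∂unif01 ≤ ENNReal.ofReal (f x + d i)) :
    ∫⁻ z, ENNReal.ofReal (f z) ∂(ustep m E x) ≤
      ENNReal.ofReal (f x + (∑ i, Real.sqrt (x.1 i) * d i) / Lam m E) := by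
  have hL := aux_Lam_pos m hm E hE
  have hr : 0 ≤ 1 - jumpRate m E x / Lam m E := by
    rw [sub_nonneg, div_le_one hL]; exact aux_rate_le m E x
  rw [ustep, lintegral_add_measure, lintegral_smul_measure, lintegral_smul_measure,
    lintegral_sum_measure, tsum_fintype, lintegral_dirac' _ (by fun_prop)]
  simp only [lintegral_smul_measure, smul_eq_mul]
  calc _ ≤ ENNReal.ofReal (1 - jumpRate m E x / Lam m E) * ENNReal.ofReal (f x)
        + (ENNReal.ofReal (Lam m E))⁻¹ * ∑ i, ENNReal.ofReal (Real.sqrt (x.1 i))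
          * ENNReal.ofReal (f x + d i) := by
        gcongr with i
        exact (lintegral_map_le _ _).trans (hj i)
    _ = _ := by
        have e : ∀ i, ENNReal.ofReal (Real.sqrt (x.1 i)) * ENNReal.ofReal (f x + d i)
            = ENNReal.ofReal (Real.sqrt (x.1 i) * (f x + d i)) := fun i =>
          (ENNReal.ofReal_mul (Real.sqrt_nonneg _)).symm
        have hn : ∀ i, 0 ≤ Real.sqrt (x.1 i) * (f x + d i) := fun i =>
          mul_nonneg (Real.sqrt_nonneg _) (hd i)
        have hn2 : 0 ≤ ∑ i, Real.sqrt (x.1 i) * (f x + d i) := Finset.sum_nonneg (fun i _ => hn i)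
        simp only [e]
        rw [← ENNReal.ofReal_sum_of_nonneg (fun i _ => hn i), ← ENNReal.ofReal_inv_of_pos hL,
          ← ENNReal.ofReal_mul hr, ← ENNReal.ofReal_mul (by positivity),
          ← ENNReal.ofReal_add (by positivity) (by positivity)]
        congr 1
        simp only [mul_add, Finset.sum_add_distrib]
        rw [← Finset.sum_mul]
        rw [jumpRate]
        field_simp
        ring

lemma aux_ustep_univ (m : ℕ) (hm : 1 ≤ m) (E : ℝ) (hE : 0 < E) (x : Delta m E) :
    ustep m E x univ ≤ 1 := by
  have := aux_ustep_le m hm E hE x (fun _ => 1) zero_le_one measurable_const (fun _ => 0)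
    (fun _ => by norm_num) (fun i => by simp [aux_unif_univ])
  simpa using this

lemma aux_step (m : ℕ) (hm : 1 ≤ m) (E : ℝ) (hE : 0 < E) (α : ℝ) (h1 : 1/4 < α) (h2 : α < 1/2) :
    ∃ c > (0:ℝ), ∃ C : ℝ, 0 ≤ C ∧ ∀ x : Delta m E,
      ∫⁻ z, ENNReal.ofReal (Vfun m E α z) ∂(ustep m E x)
        + ENNReal.ofReal (c * (Vfun m E α x) ^ (1 - 1/(4*α)))
        ≤ ENNReal.ofReal (Vfun m E α x) + ENNReal.ofReal C := by
  obtain ⟨c, hc, C, hC, H⟩ := aux_gen m hm E hE α h1 h2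
  have hL := aux_Lam_pos m hm E hE
  refine ⟨c / Lam m E, by positivity, C / Lam m E, by positivity, fun x => ?_⟩
  have hB : 0 < 1/(1-2*α) := by apply one_div_pos.mpr; linarith
  have hy := aux_tank_pos x
  have hV := aux_V_pos m E α x
  have hd : ∀ i, 0 ≤ Vfun m E α x + (min ((tank m E x) ^ (-(2*α)))
        (1/(1-2*α) * (x.1 i) ^ (-(2*α))) - (x.1 i) ^ (-(2*α)) + 1/(1-2*α) * (x.1 i) ^ (-α)
        - (tank m E x) ^ (-α)) := fun i => by
    have hx := x.2.1 i
    have a := aux_V_split m E α i x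
    have b : 0 ≤ ∑ j ∈ Finset.univ.erase i, (x.1 j) ^ (-(2*α)) :=
      Finset.sum_nonneg (fun j _ => (Real.rpow_pos_of_pos (x.2.1 j) _).le)
    have e1 : 0 ≤ min ((tank m E x) ^ (-(2*α))) (1/(1-2*α) * (x.1 i) ^ (-(2*α))) := by positivity
    have e2 : 0 ≤ 1/(1-2*α) * (x.1 i) ^ (-α) := by positivity
    linarith
  have K := aux_ustep_le m hm E hE x (Vfun m E α) hV.le (aux_V_meas m E α) _ hd
    (fun i => aux_jump m E α h1 h2 i x)
  have G := H x.1 (tank m E x) x.2.1 hy rfl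
  set D := ∑ i, Real.sqrt (x.1 i) * (min ((tank m E x) ^ (-(2*α)))
        (1/(1-2*α) * (x.1 i) ^ (-(2*α))) - (x.1 i) ^ (-(2*α)) + 1/(1-2*α) * (x.1 i) ^ (-α)
        - (tank m E x) ^ (-α)) with hD
  have hDn : 0 ≤ Vfun m E α x + D / Lam m E := by
    have q : ∑ i, Real.sqrt (x.1 i) * (-(Vfun m E α x)) ≤ D := by
      rw [hD]
      apply Finset.sum_le_sum
      intro i _
      apply mul_le_mul_of_nonneg_left _ (Real.sqrt_nonneg _)
      linarith [hd i]
    rw [← Finset.sum_mul] at q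
    have q2 : (∑ i, Real.sqrt (x.1 i)) ≤ Lam m E := aux_rate_le m E x
    have : -(Vfun m E α x) ≤ D / Lam m E := by
      rw [le_div_iff₀ hL]; nlinarith
    linarith
  have hp : 0 ≤ c / Lam m E * (Vfun m E α x) ^ (1 - 1/(4*α)) := by positivity
  refine (add_le_add_left K _).trans ?_
  rw [← ENNReal.ofReal_add hDn hp, ← ENNReal.ofReal_add hV.le (by positivity)]
  apply ENNReal.ofReal_le_ofReal
  have : D / Lam m E ≤ (C - c * (Vfun m E α x) ^ (1 - 1/(4*α))) / Lam m E := by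
    gcongr
    exact G
  have e : (C - c * (Vfun m E α x) ^ (1 - 1/(4*α))) / Lam m E
    = C / Lam m E - c / Lam m E * (Vfun m E α x) ^ (1 - 1/(4*α)) := by ring
  linarith

lemma aux_iter (m : ℕ) (hm : 1 ≤ m) (E : ℝ) (hE : 0 < E) (V : Delta m E → ENNReal)
    (hVm : Measurable V) (C : ENNReal)
    (H : ∀ x, ∫⁻ z, V z ∂(ustep m E x) ≤ V x + C) (n : ℕ) :
    ∀ x, ∫⁻ z, V z ∂(ustepIter m E n x) ≤ V x + n * C := by
  induction n with
  | zero => intro x; simp [ustepIter, lintegral_dirac' _ hVm]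
  | succ n ih =>
    intro x
    rw [ustepIter]
    calc _ ≤ ∫⁻ w, ∫⁻ z, V z ∂(ustepIter m E n w) ∂(ustep m E x) := Measure.lintegral_bind_le _ _ _
      _ ≤ ∫⁻ w, (V w + n * C) ∂(ustep m E x) := lintegral_mono ih
      _ = ∫⁻ w, V w ∂(ustep m E x) + n * C * ustep m E x univ := by
        rw [lintegral_add_right _ measurable_const, lintegral_const]
      _ ≤ (V x + C) + n * C * 1 := by
        gcongr
        · exact H x
        · exact aux_ustep_univ m hm E hE x
      _ = _ := by push_cast; ring

lemma aux_one (m : ℕ) (E : ℝ) (V : Delta m E → ENNReal) (hVm : Measurable V) (x : Delta m E) :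
    ∫⁻ z, V z ∂(ustepIter m E 1 x) ≤ ∫⁻ z, V z ∂(ustep m E x) := by
  rw [ustepIter]
  refine (Measure.lintegral_bind_le _ _ _).trans (lintegral_mono fun w => ?_)
  simp [ustepIter, lintegral_dirac' _ hVm]

lemma aux_weights (l : ℝ) (hl : 0 < l) :
    (∑' n : ℕ, ENNReal.ofReal (Real.exp (-l) * l ^ n / n.factorial) = 1) ∧
    (∑' n : ℕ, ENNReal.ofReal (Real.exp (-l) * l ^ n / n.factorial) * n = ENNReal.ofReal l) := by
  have hs : HasSum (fun n : ℕ => Real.exp (-l) * l ^ n / n.factorial) 1 := by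
    have := (NormedSpace.expSeries_div_hasSum_exp (𝔸 := ℝ) l).mul_left (Real.exp (-l))
    rw [← Real.exp_eq_exp_ℝ, ← Real.exp_add, neg_add_cancel, Real.exp_zero] at this
    simpa [mul_div_assoc] using this
  have h1 : ∑' n : ℕ, ENNReal.ofReal (Real.exp (-l) * l ^ n / n.factorial) = 1 := by
    rw [← ENNReal.ofReal_tsum_of_nonneg (fun n => by positivity) hs.summable, hs.tsum_eq,
      ENNReal.ofReal_one]
  refine ⟨h1, ?_⟩
  rw [tsum_eq_zero_add' ENNReal.summable]
  have e : ∀ n : ℕ, ENNReal.ofReal (Real.exp (-l) * l ^ (n+1) / (n+1).factorial) * ((n+1 : ℕ) : ENNReal)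
      = ENNReal.ofReal (Real.exp (-l) * l ^ n / n.factorial) * ENNReal.ofReal l := fun n => by
    rw [← ENNReal.ofReal_natCast, ← ENNReal.ofReal_mul (by positivity),
      ← ENNReal.ofReal_mul (by positivity)]
    congr 1
    rw [Nat.factorial_succ]; push_cast
    field_simp
    ring
  simp only [e]
  rw [ENNReal.tsum_mul_right, h1]
  simp

/-- Theorem 2.1, Lyapunov drift for the time-`h` semigroup.
There is `α₁ ∈ (1/4, 1/2)` such that for every `α ∈ (α₁, 1/2)` there is `h₁ > 0` such
that for all `h ∈ (0, h₁)` there are `c₀, M > 0` with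
`(P^h V)(x) - V(x) ≤ -c₀ V(x)^β` (with `V = V_α`, `β = 1 - 1/(4α)`)
whenever `V(x) > M`.  (The inequality is stated as
`∫ V d(P^h(x,·)) ≤ V(x) - c₀ V(x)^β`, which in particular contains the finiteness of
`(P^h V)(x)`.) -/
theorem lyapunov_drift (m : ℕ) (hm : 1 ≤ m) (E : ℝ) (hE : 0 < E) :
    ∃ α₁ : ℝ, 1/4 < α₁ ∧ α₁ < 1/2 ∧
      ∀ α : ℝ, α₁ < α → α < 1/2 →
        ∃ h₁ > (0:ℝ), ∀ h : ℝ, 0 < h → h < h₁ →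
          ∃ c₀ > (0:ℝ), ∃ M > (0:ℝ), ∀ x : Delta m E, M < Vfun m E α x →
            ∫⁻ z, ENNReal.ofReal (Vfun m E α z) ∂(Pt m E h x)
              ≤ ENNReal.ofReal
                  (Vfun m E α x - c₀ * (Vfun m E α x) ^ (1 - 1 / (4 * α))) := by

  refine ⟨3/8, by norm_num, by norm_num, fun α ha1 h2 => ⟨1, one_pos, fun h hh _ => ?_⟩⟩
  have h1 : 1/4 < α := by linarith
  obtain ⟨c, hc, C, hC, H⟩ := aux_step m hm E hE α h1 h2
  have hL := aux_Lam_pos m hm E hE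
  set l := Lam m E * h with hl
  have hlp : 0 < l := by positivity
  obtain ⟨W1, W2⟩ := aux_weights l hlp
  set w : ℕ → ENNReal := fun n => ENNReal.ofReal (Real.exp (-l) * l ^ n / n.factorial) with hw
  set β : ℝ := 1 - 1/(4*α) with hβ
  have hβ0 : 0 < β := by
    rw [hβ, sub_pos, div_lt_one (by linarith)]; linarith
  set w1 : ℝ := Real.exp (-l) * l with hw1
  have hw1p : 0 < w1 := by positivity
  refine ⟨w1 * c / 2, by positivity, (2 * (l * C) / (w1 * c)) ^ (1/β) + 1, by positivity,
    fun x hx => ?_⟩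
  have hV := aux_V_pos m E α x
  set v := Vfun m E α x with hv
  have hVm : Measurable (fun z : Delta m E => ENNReal.ofReal (Vfun m E α z)) :=
    (aux_V_meas m E α).ennreal_ofReal
  have hbase : ∫⁻ z, ENNReal.ofReal (Vfun m E α z) ∂(Pt m E h x)
      = ∑' n, w n * ∫⁻ z, ENNReal.ofReal (Vfun m E α z) ∂(ustepIter m E n x) := by
    rw [Pt, lintegral_sum_measure]
    simp only [lintegral_smul_measure, smul_eq_mul, neg_mul]
    rfl
  have hiter : ∀ n, ∫⁻ z, ENNReal.ofReal (Vfun m E α z) ∂(ustepIter m E n x)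
      + (if n = 1 then ENNReal.ofReal (c * v ^ β) else 0)
      ≤ ENNReal.ofReal v + n * ENNReal.ofReal C := by
    intro n
    split_ifs with hn
    · subst hn
      have := (add_le_add_left (aux_one m E _ hVm x) _).trans (H x)
      simpa using this
    · rw [add_zero]
      exact aux_iter m hm E hE _ hVm _ (fun z => le_self_add.trans (H z)) n x
  have hsum := ENNReal.tsum_le_tsum (fun n => mul_le_mul_right (hiter n) (w n))
  simp only [mul_add] at hsum
  rw [ENNReal.tsum_add, ENNReal.tsum_add, ← hbase, ENNReal.tsum_mul_right, W1, one_mul] at hsum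
  have e1 : ∑' n : ℕ, w n * (n * ENNReal.ofReal C) = ENNReal.ofReal (l * C) := by
    simp only [← mul_assoc]
    rw [ENNReal.tsum_mul_right, W2, ← ENNReal.ofReal_mul hlp.le]
  have e2 : ∑' n : ℕ, w n * (if n = 1 then ENNReal.ofReal (c * v ^ β) else 0)
      = ENNReal.ofReal (w1 * (c * v ^ β)) := by
    rw [tsum_eq_single 1 (fun n hn => by simp [hn]), if_pos rfl, ENNReal.ofReal_mul hw1p.le]
    simp [hw, hw1]
  rw [e1, e2, ← ENNReal.ofReal_add hV.le (by positivity)] at hsum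
  have hfin := ENNReal.le_sub_of_add_le_right ENNReal.ofReal_ne_top hsum
  rw [← ENNReal.ofReal_sub _ (by positivity)] at hfin
  refine hfin.trans (ENNReal.ofReal_le_ofReal ?_)
  have hbig : 2 * (l * C) / (w1 * c) ≤ v ^ β := by
    have q0 : 0 ≤ 2 * (l * C) / (w1 * c) := by positivity
    calc 2 * (l * C) / (w1 * c) = ((2 * (l * C) / (w1 * c)) ^ (1/β)) ^ β := by
          rw [← Real.rpow_mul q0, one_div_mul_cancel hβ0.ne', Real.rpow_one]
      _ ≤ v ^ β := by
          apply Real.rpow_le_rpow (by positivity) _ hβ0.le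
          linarith
  rw [div_le_iff₀ (by positivity)] at hbig
  linarith
end

section
/- One-jump drift inequality: for every α ∈ (1/4, 1/2), with β = 1 − 1/(4α), there exist constants ε₀ > 0 and c* > 0 such that for every x ∈ B_{ε₀}, Σ_{i=1}^m Q_i(x) ≤ −c* V_α(x)^β; equivalently, if K denotes the embedded jump kernel (choose particle i with probability √(x^i)/Σ_{j=1}^m √(x^j), draw u uniform on (0,1), and apply T_{i,u}), then ∫ V_α dK(x,·) ≤ V_α(x) − (c* / Σ_{i=1}^m √(x^i)) V_α(x)^β for every x ∈ B_{ε₀}. -/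
open MeasureTheory Set Filter

/-- `Q_i(x) = √(x^i) ( ∫_0^1 [(x^i(1-u²)+y)^{-2α} + (x^i u²)^{-α}] du - (x^i)^{-2α} - y^{-α} )`.
This is the expected change of `V_α` at a jump, weighted by the jump rate of particle `i`. -/
noncomputable def Qi (m : ℕ) (E : ℝ) (α : ℝ) (i : Fin m) (x : Delta m E) : ℝ :=
  Real.sqrt (x.1 i) *
    ((∫ u in (0:ℝ)..1,
        ((x.1 i * (1 - u ^ 2) + tank m E x) ^ (-(2 * α)) + (x.1 i * u ^ 2) ^ (-α)))
      - (x.1 i) ^ (-(2 * α)) - (tank m E x) ^ (-α))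

/-- The boundary region `B_{ε₀} = {x ∈ Δ : y < ε₀, or x^i < 4^{-1/(2α)} ε₀ for some i}`. -/
def Bset (m : ℕ) (E : ℝ) (α ε₀ : ℝ) : Set (Delta m E) :=
  {x | tank m E x < ε₀ ∨ ∃ i, x.1 i < (4:ℝ) ^ (-(1 / (2 * α))) * ε₀}

lemma ojd_int1 {α a y : ℝ} (h0 : 0 < α) (ha : 0 < a) (hy : 0 < y) :
    IntervalIntegrable (fun u : ℝ => (a * (1 - u ^ 2) + y) ^ (-(2 * α))) volume 0 1 := by
  apply ContinuousOn.intervalIntegrable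
  rw [uIcc_of_le zero_le_one]
  intro u hu
  apply ContinuousAt.continuousWithinAt
  apply ContinuousAt.rpow_const (by fun_prop)
  left
  have : 0 ≤ 1 - u ^ 2 := by nlinarith [hu.1, hu.2]
  positivity

lemma ojd_int1_le_y {α a y : ℝ} (h0 : 0 < α) (ha : 0 < a) (hy : 0 < y) :
    (∫ u in (0:ℝ)..1, (a * (1 - u ^ 2) + y) ^ (-(2 * α))) ≤ y ^ (-(2 * α)) := by
  have : (∫ u in (0:ℝ)..1, (a * (1 - u ^ 2) + y) ^ (-(2 * α)))
      ≤ ∫ u in (0:ℝ)..1, y ^ (-(2 * α)) := by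
    apply intervalIntegral.integral_mono_on zero_le_one (ojd_int1 h0 ha hy) (by simp)
    intro u hu
    have : 0 ≤ 1 - u ^ 2 := by nlinarith [hu.1, hu.2]
    apply Real.rpow_le_rpow_of_nonpos hy _ (by linarith)
    nlinarith
  simpa using this

lemma ojd_int1_le_a {α a y : ℝ} (h0 : 0 < α) (h2 : α < 1/2) (ha : 0 < a) (hy : 0 < y) :
    (∫ u in (0:ℝ)..1, (a * (1 - u ^ 2) + y) ^ (-(2 * α)))
      ≤ a ^ (-(2 * α)) * (1 / (1 - 2 * α)) := by
  have hI : IntervalIntegrable (fun u : ℝ => u ^ (-(2 * α))) volume 0 1 :=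
    intervalIntegral.intervalIntegrable_rpow' (by linarith)
  have hI' : IntervalIntegrable (fun u : ℝ => (1 - u) ^ (-(2 * α))) volume 0 1 := by
    have := (hI.comp_sub_left 1).symm
    simpa using this
  have hv : (∫ u in (0:ℝ)..1, (1 - u) ^ (-(2 * α))) = 1 / (1 - 2 * α) := by
    rw [intervalIntegral.integral_comp_sub_left (fun u : ℝ => u ^ (-(2 * α))) 1]
    simp only [sub_self, sub_zero]
    rw [integral_rpow (Or.inl (by linarith))]
    rw [Real.one_rpow, Real.zero_rpow (by linarith)]
    ring_nf
  rw [← hv, ← intervalIntegral.integral_const_mul]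
  apply intervalIntegral.integral_mono_on_of_le_Ioo zero_le_one (ojd_int1 h0 ha hy)
    (hI'.const_mul _)
  intro u hu
  have h1 : 0 < 1 - u := by linarith [hu.2]
  rw [← Real.mul_rpow ha.le h1.le]
  apply Real.rpow_le_rpow_of_nonpos (by positivity) _ (by linarith)
  have : 0 ≤ a * (u * (1 - u)) := by
    have := hu.1
    positivity
  nlinarith

lemma ojd_fun2 {α a : ℝ} (ha : 0 < a) : EqOn (fun u : ℝ => (a * u ^ 2) ^ (-α))
    (fun u => a ^ (-α) * u ^ (-(2 * α))) (uIcc (0:ℝ) 1) := by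
  intro u hu
  rw [uIcc_of_le zero_le_one] at hu
  simp only
  rw [Real.mul_rpow ha.le (by positivity), ← Real.rpow_natCast, ← Real.rpow_mul hu.1]
  congr 2
  push_cast
  ring

lemma ojd_int2 {α a : ℝ} (h2 : α < 1/2) (ha : 0 < a) :
    IntervalIntegrable (fun u : ℝ => (a * u ^ 2) ^ (-α)) volume 0 1 ∧
    (∫ u in (0:ℝ)..1, (a * u ^ 2) ^ (-α)) = a ^ (-α) * (1 / (1 - 2 * α)) := by
  have hI : IntervalIntegrable (fun u : ℝ => u ^ (-(2 * α))) volume 0 1 :=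
    intervalIntegral.intervalIntegrable_rpow' (by linarith)
  constructor
  · apply (hI.const_mul (a ^ (-α))).congr
    intro u hu
    exact (ojd_fun2 ha (uIoc_subset_uIcc hu)).symm
  · rw [intervalIntegral.integral_congr (ojd_fun2 ha), intervalIntegral.integral_const_mul,
      integral_rpow (Or.inl (by linarith))]
    rw [Real.one_rpow, Real.zero_rpow (by linarith)]
    ring_nf

lemma ojd_sqrt_mul {a : ℝ} (ha : 0 < a) (s : ℝ) : Real.sqrt a * a ^ s = a ^ (1/2 + s) := by
  rw [Real.sqrt_eq_rpow, ← Real.rpow_add ha]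

lemma ojd_I {α : ℝ} (h1 : 1/4 < α) (h2 : α < 1/2) : ∃ C > (0:ℝ), ∀ a y : ℝ, 0 < a → 0 < y →
    Real.sqrt a * (∫ u in (0:ℝ)..1, (a * (1 - u ^ 2) + y) ^ (-(2 * α)))
      ≤ 1/4 * a ^ (1/2 - 2 * α) + C * y ^ (1/2 - 2 * α) := by
  have h0 : 0 < α := by linarith
  have hc : 0 < 1 / (1 - 2 * α) := one_div_pos.2 (by linarith)
  set k : ℝ := 4 ^ (1 / (2 * α)) with hk
  have hk0 : 0 < k := by positivity
  refine ⟨1 / (1 - 2 * α) * k⁻¹ ^ (1/2 - 2 * α), by positivity, fun a y ha hy => ?_⟩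
  have e : Real.sqrt a * a ^ (-(2 * α)) = a ^ (1/2 - 2 * α) := by
    rw [ojd_sqrt_mul ha]; ring_nf
  rcases le_or_gt (k * a) y with h | h
  · have hb := ojd_int1_le_y h0 ha hy
    have : y ^ (-(2 * α)) ≤ (k * a) ^ (-(2 * α)) :=
      Real.rpow_le_rpow_of_nonpos (by positivity) h (by linarith)
    have hk4 : k ^ (-(2 * α)) = 1/4 := by
      rw [hk, ← Real.rpow_mul (by norm_num)]
      have : 1 / (2 * α) * -(2 * α) = -1 := by field_simp
      rw [this, Real.rpow_neg_one]; norm_num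
    rw [Real.mul_rpow hk0.le ha.le, hk4] at this
    have h3 := mul_le_mul_of_nonneg_left (hb.trans this) (Real.sqrt_nonneg a)
    have h4 : 0 ≤ 1 / (1 - 2 * α) * k⁻¹ ^ (1/2 - 2 * α) * y ^ (1/2 - 2 * α) := by positivity
    calc _ ≤ _ := h3
      _ = 1/4 * (Real.sqrt a * a ^ (-(2 * α))) := by ring
      _ ≤ _ := by rw [e]; linarith
  · have hb := ojd_int1_le_a h0 h2 ha hy
    have h3 := mul_le_mul_of_nonneg_left hb (Real.sqrt_nonneg a)
    have h5 : a ^ (1/2 - 2 * α) ≤ (k⁻¹ * y) ^ (1/2 - 2 * α) := by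
      apply Real.rpow_le_rpow_of_nonpos (by positivity) _ (by linarith)
      rw [inv_mul_le_iff₀ hk0]; exact h.le
    rw [Real.mul_rpow (by positivity) hy.le] at h5
    have h4 : 0 ≤ a ^ (1/2 - 2 * α) := by positivity
    calc _ ≤ _ := h3
      _ = 1 / (1 - 2 * α) * (Real.sqrt a * a ^ (-(2 * α))) := by ring
      _ = 1 / (1 - 2 * α) * a ^ (1/2 - 2 * α) := by rw [e]
      _ ≤ 1 / (1 - 2 * α) * (k⁻¹ ^ (1/2 - 2 * α) * y ^ (1/2 - 2 * α)) := by gcongr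
      _ ≤ _ := by linarith

lemma ojd_Q (m : ℕ) (E : ℝ) {α : ℝ} (h1 : 1/4 < α) (h2 : α < 1/2) :
    ∃ C > (0:ℝ), ∃ D > (0:ℝ), ∀ (x : Delta m E) (i : Fin m),
      Qi m E α i x ≤ -(3/4) * (x.1 i) ^ (1/2 - 2 * α) + C * (tank m E x) ^ (1/2 - 2 * α) + D
        - (tank m E x) ^ (-α) * Real.sqrt (x.1 i) := by
  obtain ⟨C, hC, hI⟩ := ojd_I h1 h2
  have hc : 0 < 1 / (1 - 2 * α) := one_div_pos.2 (by linarith)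
  refine ⟨C, hC, 1 / (1 - 2 * α) * (|E| ^ (1/2 - α)) + 1, by positivity, fun x i => ?_⟩
  have ha : 0 < x.1 i := x.2.1 i
  have hy : 0 < tank m E x := sub_pos.2 x.2.2
  have hle : x.1 i ≤ E := by
    have := Finset.single_le_sum (f := x.1) (fun j _ => (x.2.1 j).le) (Finset.mem_univ i)
    linarith [x.2.2]
  have hq := hI _ _ ha hy
  obtain ⟨hi2, hv2⟩ := ojd_int2 h2 ha
  unfold Qi
  rw [intervalIntegral.integral_add (ojd_int1 (by linarith) ha hy) hi2, hv2]
  have e : Real.sqrt (x.1 i) * (x.1 i) ^ (-(2 * α)) = (x.1 i) ^ (1/2 - 2 * α) := by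
    rw [ojd_sqrt_mul ha]; ring_nf
  have e2 : Real.sqrt (x.1 i) * (x.1 i) ^ (-α) = (x.1 i) ^ (1/2 - α) := by
    rw [ojd_sqrt_mul ha]; ring_nf
  have h3 : (x.1 i) ^ (1/2 - α) ≤ |E| ^ (1/2 - α) :=
    Real.rpow_le_rpow ha.le (hle.trans (le_abs_self E)) (by linarith)
  have h4 := mul_le_mul_of_nonneg_left h3 hc.le
  rw [← e2] at h4
  rw [← e] at hq ⊢
  linarith

lemma ojd_large {p : ℝ} (hp : 0 < p) (M : ℝ) : ∃ η > (0:ℝ), ∀ y, 0 < y → y < η → M ≤ y ^ (-p) := by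
  have := (tendsto_rpow_neg_nhdsGT_zero (neg_lt_zero.2 hp)).eventually (eventually_ge_atTop M)
  rw [eventually_nhdsWithin_iff, Metric.eventually_nhds_iff] at this
  obtain ⟨η, h, H⟩ := this
  refine ⟨η, h, fun y hy hy' => H ?_ hy⟩
  rw [Real.dist_eq, sub_zero, abs_of_pos hy]; exact hy'

lemma ojd_absorb {p q : ℝ} (hp : 0 < p) (hpq : p < q) {K δ : ℝ} (hK : 0 < K) (hδ : 0 < δ) :
    ∃ C > (0:ℝ), ∀ y, 0 < y → K * y ^ (-p) ≤ δ * y ^ (-q) + C := by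
  obtain ⟨η, h, H⟩ := ojd_large (sub_pos.2 hpq) (K / δ)
  refine ⟨K * η ^ (-p), by positivity, fun y hy => ?_⟩
  rcases lt_or_ge y η with hlt | hge
  · have h1 := H y hy hlt
    have e : y ^ (-q) = y ^ (-(q - p)) * y ^ (-p) := by
      rw [← Real.rpow_add hy]; ring_nf
    have h3 : K ≤ δ * y ^ (-(q - p)) := by rwa [div_le_iff₀' hδ] at h1
    have h4 := mul_le_mul_of_nonneg_right h3 (Real.rpow_nonneg hy.le (-p))
    rw [e]
    have : 0 < K * η ^ (-p) := by positivity
    linarith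
  · have h1 : y ^ (-p) ≤ η ^ (-p) := Real.rpow_le_rpow_of_nonpos h hge (by linarith)
    have h2 := mul_le_mul_of_nonneg_left h1 hK.le
    have : 0 < δ * y ^ (-q) := by positivity
    linarith

lemma ojd_sum_rpow {ι : Type*} (s : Finset ι) (f : ι → ℝ) (hf : ∀ i, 0 ≤ f i) {p : ℝ}
    (hp : 0 < p) (hp1 : p ≤ 1) : (∑ i ∈ s, f i) ^ p ≤ ∑ i ∈ s, f i ^ p := by
  classical
  induction s using Finset.induction_on with
  | empty => simp [Real.zero_rpow hp.ne']
  | insert a s ha ih =>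
    rw [Finset.sum_insert ha, Finset.sum_insert ha]
    have := Real.rpow_add_le_add_rpow (hf a) (Finset.sum_nonneg (fun i _ => hf i) : 0 ≤ ∑ i ∈ s, f i)
      hp.le hp1
    linarith

lemma ojd_V (m : ℕ) (E : ℝ) (hE : 0 < E) {α : ℝ} (h1 : 1/4 < α) (h2 : α < 1/2) (x : Delta m E) :
    (Vfun m E α x) ^ (1 - 1 / (4 * α)) ≤
      (1 + E ^ (1/4 : ℝ)) * (∑ i, (x.1 i) ^ (1/2 - 2 * α) + (tank m E x) ^ (-α)) := by
  have hy : 0 < tank m E x := sub_pos.2 x.2.2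
  have hyE : tank m E x ≤ E := by
    have := Finset.sum_nonneg (fun j (_ : j ∈ Finset.univ) => (x.2.1 j).le)
    unfold tank; linarith
  have ha0 : 0 < α := by linarith
  have hb0 : 0 < 1 - 1 / (4 * α) := by
    rw [sub_pos, div_lt_one (by positivity)]; linarith
  have hb1 : 1 - 1 / (4 * α) ≤ 1 := by
    have : 0 < 1 / (4 * α) := by positivity
    linarith
  have hs : 0 ≤ ∑ i, (x.1 i) ^ (-(2 * α)) :=
    Finset.sum_nonneg (fun i _ => Real.rpow_nonneg (x.2.1 i).le _)
  have A := Real.rpow_add_le_add_rpow hs (Real.rpow_nonneg hy.le (-α)) hb0.le hb1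
  have B := ojd_sum_rpow Finset.univ (fun i => (x.1 i) ^ (-(2 * α)))
    (fun i => Real.rpow_nonneg (x.2.1 i).le _) hb0 hb1
  have C : ∀ i, ((x.1 i) ^ (-(2 * α))) ^ (1 - 1 / (4 * α)) = (x.1 i) ^ (1/2 - 2 * α) := by
    intro i
    rw [← Real.rpow_mul (x.2.1 i).le]
    congr 1; field_simp; ring
  simp only [C] at B
  have D : ((tank m E x) ^ (-α)) ^ (1 - 1 / (4 * α))
      = (tank m E x) ^ (1/4 : ℝ) * (tank m E x) ^ (-α) := by
    rw [← Real.rpow_mul hy.le, ← Real.rpow_add hy]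
    congr 1; field_simp; ring
  have F : (tank m E x) ^ (1/4 : ℝ) ≤ E ^ (1/4 : ℝ) := Real.rpow_le_rpow hy.le hyE (by norm_num)
  have G := mul_le_mul_of_nonneg_right F (Real.rpow_nonneg hy.le (-α))
  have S : 0 ≤ ∑ i, (x.1 i) ^ (1/2 - 2 * α) :=
    Finset.sum_nonneg (fun i _ => Real.rpow_nonneg (x.2.1 i).le _)
  have S1 : 0 ≤ E ^ (1/4 : ℝ) * ∑ i, (x.1 i) ^ (1/2 - 2 * α) := by positivity
  have S2 : 0 ≤ (tank m E x) ^ (-α) := Real.rpow_nonneg hy.le _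
  unfold Vfun
  rw [D] at A
  linarith

/-- Lemma 2.2, one-jump drift inequality. For every `α ∈ (1/4, 1/2)`,
with `β = 1 - 1/(4α)`, there are `ε₀, c* > 0` such that `∑ i, Q_i(x) ≤ -c* V_α(x)^β`
for every `x ∈ B_{ε₀}`. -/
theorem one_jump_drift (m : ℕ) (hm : 1 ≤ m) (E : ℝ) (hE : 0 < E)
    (α : ℝ) (hα1 : 1/4 < α) (hα2 : α < 1/2) :
    ∃ ε₀ > (0:ℝ), ∃ cstar > (0:ℝ), ∀ x ∈ Bset m E α ε₀,
      ∑ i, Qi m E α i x ≤ -cstar * (Vfun m E α x) ^ (1 - 1 / (4 * α)) := by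
  obtain ⟨C, hC, D, hD, hQ⟩ := ojd_Q m E hα1 hα2
  have hm0 : (0:ℝ) < m := by exact_mod_cast hm
  have hs : 0 < (E / 2) ^ (1/2 : ℝ) := by positivity
  set s : ℝ := (E / 2) ^ (1/2 : ℝ) with hsdef
  obtain ⟨C3, hC3, hA⟩ := ojd_absorb (p := 2 * α - 1/2) (q := α) (by linarith) (by linarith)
    (mul_pos hm0 hC) (half_pos hs)
  set L : ℝ := C3 + m * D + s * (E / 2) ^ (-α) with hL
  have hL0 : 0 < L := by positivity
  set c : ℝ := min (3/4) (s / 2) with hc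
  have hc0 : 0 < c := by positivity
  have hR : 0 < 1 + E ^ (1/4 : ℝ) := by positivity
  obtain ⟨η1, hη1, H1⟩ := ojd_large (p := α) (by linarith) (2 * L / c)
  obtain ⟨η2, hη2, H2⟩ := ojd_large (p := 2 * α - 1/2) (by linarith) (2 * L / c)
  refine ⟨min η1 η2, by positivity, c / 2 / (1 + E ^ (1/4 : ℝ)), by positivity, fun x hx => ?_⟩
  have hy : 0 < tank m E x := sub_pos.2 x.2.2
  have hp : ∀ z : ℝ, z ^ (-(2 * α - 1/2)) = z ^ (1/2 - 2 * α) := fun z => by congr 1; ring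
  have hnn : ∀ i, 0 ≤ (x.1 i) ^ (1/2 - 2 * α) := fun i => Real.rpow_nonneg (x.2.1 i).le _
  set S := ∑ i, (x.1 i) ^ (1/2 - 2 * α) with hS
  set Y := (tank m E x) ^ (-α) with hY
  have hS0 : 0 ≤ S := Finset.sum_nonneg (fun i _ => hnn i)
  have hY0 : 0 < Y := by positivity
  have hV := ojd_V m E hE hα1 hα2 x
  -- lower bound on the total rate
  have hrate : s * Y - s * (E / 2) ^ (-α) ≤ Y * ∑ i, Real.sqrt (x.1 i) := by
    have hq0 : 0 ≤ ∑ i, Real.sqrt (x.1 i) := Finset.sum_nonneg (fun i _ => Real.sqrt_nonneg _)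
    rcases le_or_gt (tank m E x) (E / 2) with h | h
    · have h1 : s ≤ ∑ i, Real.sqrt (x.1 i) := by
        have := ojd_sum_rpow Finset.univ x.1 (fun i => (x.2.1 i).le) (p := 1/2)
          (by norm_num) (by norm_num)
        simp only [Real.sqrt_eq_rpow]
        refine le_trans ?_ this
        apply Real.rpow_le_rpow (by positivity) _ (by norm_num)
        unfold tank at h; linarith
      have h2 := mul_le_mul_of_nonneg_left h1 hY0.le
      have : 0 < s * (E / 2) ^ (-α) := by positivity
      linarith
    · have h1 : Y ≤ (E / 2) ^ (-α) :=
        Real.rpow_le_rpow_of_nonpos (by positivity) h.le (by linarith)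
      have h2 := mul_le_mul_of_nonneg_left h1 hs.le
      have : 0 ≤ Y * ∑ i, Real.sqrt (x.1 i) := by positivity
      linarith
  have hsum : ∑ i, Qi m E α i x ≤ -(3/4) * S + m * C * (tank m E x) ^ (1/2 - 2 * α) + m * D
      - Y * ∑ i, Real.sqrt (x.1 i) := by
    refine (Finset.sum_le_sum (fun i _ => hQ x i)).trans (le_of_eq ?_)
    rw [Finset.sum_sub_distrib, Finset.sum_add_distrib, Finset.sum_add_distrib,
      hS, hY, Finset.mul_sum, Finset.mul_sum]
    simp only [Finset.sum_const, Finset.card_univ, Fintype.card_fin, nsmul_eq_mul]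
    ring
  have hA' := hA _ hy
  rw [hp] at hA'
  have k1 : c * S ≤ 3/4 * S := mul_le_mul_of_nonneg_right (min_le_left _ _) hS0
  have k2 : c * Y ≤ s / 2 * Y := mul_le_mul_of_nonneg_right (min_le_right _ _) hY0.le
  have hW : 2 * L / c ≤ S + Y := by
    rcases hx with h | ⟨i, h⟩
    · have := H1 _ hy (h.trans_le (min_le_left _ _))
      linarith
    · have h4 : (4:ℝ) ^ (-(1 / (2 * α))) ≤ 1 := by
        apply Real.rpow_le_one_of_one_le_of_nonpos (by norm_num)
        have : 0 < 1 / (2 * α) := one_div_pos.2 (by linarith)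
        linarith
      have h5 : x.1 i < η2 := by
        have h6 : (4:ℝ) ^ (-(1 / (2 * α))) * min η1 η2 ≤ 1 * min η1 η2 :=
          mul_le_mul_of_nonneg_right h4 (by positivity)
        linarith [min_le_right η1 η2]
      have := H2 _ (x.2.1 i) h5
      rw [hp] at this
      have h7 := Finset.single_le_sum (f := fun i => (x.1 i) ^ (1/2 - 2 * α))
        (fun j _ => hnn j) (Finset.mem_univ i)
      linarith
  rw [div_le_iff₀ hc0] at hW
  have hfin : ∑ i, Qi m E α i x ≤ -(c / 2) * (S + Y) := by linarith
  refine hfin.trans ?_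
  have := mul_le_mul_of_nonneg_left hV (by positivity : 0 ≤ c / 2 / (1 + E ^ (1/4 : ℝ)))
  have e : c / 2 / (1 + E ^ (1/4 : ℝ)) * ((1 + E ^ (1/4 : ℝ)) * (S + Y)) = c / 2 * (S + Y) := by
    field_simp
  rw [e] at this
  linarith
end

section
/- For every α ∈ (1/4, 1/2), every ε₀ > 0, and every h > 0, the function P^h V_α is uniformly bounded away from the boundary region: sup_{x ∈ Δ∖B_{ε₀}} (P^h V_α)(x) < ∞. -/
open MeasureTheory Set Filter

lemma Vfun_meas (m : ℕ) (E α : ℝ) :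
    Measurable (fun z : Delta m E => ENNReal.ofReal (Vfun m E α z)) := by
  unfold Vfun tank
  have hc : ∀ i : Fin m, Measurable (fun z : Delta m E => z.1 i) :=
    fun i => (measurable_pi_apply i).comp measurable_subtype_coe
  apply Measurable.ennreal_ofReal
  apply Measurable.add
  · exact Finset.measurable_sum _ fun i _ => (hc i).pow_const _
  · exact (measurable_const.sub (Finset.measurable_sum _ fun i _ => hc i)).pow_const _

lemma Vfun_exch_le (m : ℕ) (E : ℝ) (hE : 0 < E) (α : ℝ) (hα1 : 1/4 < α)
    (x : Delta m E) (i : Fin m) (u : ℝ) (hu : u ∈ Ioo (0:ℝ) 1) :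
    Vfun m E α (Texch m E i u x) ≤
      (1 + (1 - u) ^ (-(2 * α)) + E ^ α * u ^ (-(2 * α))) * Vfun m E α x := by
  obtain ⟨x, hx⟩ := x
  have hmem := T0_mem (i := i) hx hu
  obtain ⟨hpos, hsum⟩ := hx
  obtain ⟨hu0, hu1⟩ := id hu
  have hy : 0 < E - ∑ j, x j := sub_pos.mpr hsum
  have hxi := hpos i
  have hlt : x i < E := lt_of_le_of_lt
    (Finset.single_le_sum (f := x) (fun j _ => (hpos j).le) (Finset.mem_univ i)) hsum
  have hsum0 : ∑ j ∈ Finset.univ \ {i}, x j = (∑ j, x j) - x i := by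
    rw [← Finset.erase_eq]
    exact Finset.sum_erase_eq_sub (Finset.mem_univ i)
  have htank : E - ∑ j, T0 m E i u x j = u ^ 2 * x i := by
    simp only [T0]
    rw [Finset.sum_update_of_mem (Finset.mem_univ i), hsum0]
    ring
  have hT : Texch m E i u ⟨x, ⟨hpos, hsum⟩⟩ = ⟨T0 m E i u x, hmem⟩ := by
    simp only [Texch, dif_pos hu]
  rw [hT]
  simp only [Vfun, tank, htank]
  set S := ∑ j, x j ^ (-(2 * α)) with hS
  have hSi : x i ^ (-(2 * α)) ≤ S :=
    Finset.single_le_sum (f := fun j => x j ^ (-(2 * α)))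
      (fun j _ => Real.rpow_nonneg (hpos j).le _) (Finset.mem_univ i)
  have hY : 0 ≤ (E - ∑ j, x j) ^ (-α) := Real.rpow_nonneg hy.le _
  -- particle part
  have h1 : (T0 m E i u x i) ^ (-(2 * α)) ≤ (1 - u) ^ (-(2 * α)) * x i ^ (-(2 * α)) := by
    rw [← Real.mul_rpow (by linarith) hxi.le]
    apply Real.rpow_le_rpow_of_nonpos (mul_pos (by linarith) hxi) _ (by linarith)
    simp only [T0, Function.update_self]
    nlinarith [mul_pos (mul_pos hu0 (sub_pos.2 hu1)) hxi]
  have h2 : ∑ j, (T0 m E i u x j) ^ (-(2 * α)) ≤ S + (1 - u) ^ (-(2 * α)) * x i ^ (-(2 * α)) := by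
    rw [← Finset.add_sum_erase _ _ (Finset.mem_univ i)]
    have : ∑ j ∈ Finset.univ.erase i, (T0 m E i u x j) ^ (-(2 * α)) ≤ S := by
      rw [hS]
      calc _ = ∑ j ∈ Finset.univ.erase i, (x j) ^ (-(2 * α)) := by
            apply Finset.sum_congr rfl
            intro j hj
            simp only [T0, Function.update_of_ne (Finset.ne_of_mem_erase hj)]
        _ ≤ _ := Finset.sum_le_sum_of_subset_of_nonneg (Finset.erase_subset _ _)
            (fun j _ _ => Real.rpow_nonneg (hpos j).le _)
    linarith
  have h3 : (u ^ 2 * x i) ^ (-α) ≤ E ^ α * u ^ (-(2 * α)) * x i ^ (-(2 * α)) := by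
    rw [Real.mul_rpow (by positivity) hxi.le, ← Real.rpow_natCast, ← Real.rpow_mul hu0.le]
    have e1 : ((2:ℕ):ℝ) * -α = -(2 * α) := by push_cast; ring
    rw [e1]
    have e2 : x i ^ (-α) = x i ^ α * x i ^ (-(2 * α)) := by
      rw [← Real.rpow_add hxi]; congr 1; ring
    have e3 : x i ^ α ≤ E ^ α := Real.rpow_le_rpow hxi.le hlt.le (by linarith)
    have p1 : 0 ≤ u ^ (-(2 * α)) := Real.rpow_nonneg hu0.le _
    have p2 : 0 ≤ x i ^ (-(2 * α)) := Real.rpow_nonneg hxi.le _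
    rw [e2]
    nlinarith [mul_le_mul_of_nonneg_right e3 (mul_nonneg p1 p2)]
  have p1 : 0 ≤ (1 - u) ^ (-(2 * α)) := Real.rpow_nonneg (by linarith) _
  have p2 : 0 ≤ E ^ α * u ^ (-(2 * α)) := by positivity
  have q1 := mul_le_mul_of_nonneg_left hSi p1
  have q2 := mul_le_mul_of_nonneg_left hSi p2
  have q3 := mul_nonneg p1 hY
  have q4 := mul_nonneg p2 hY
  nlinarith

lemma Vfun_nonneg (m : ℕ) (E α : ℝ) (x : Delta m E) : 0 ≤ Vfun m E α x := by
  have := x.2.2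
  exact add_nonneg (Finset.sum_nonneg fun j _ => Real.rpow_nonneg (x.2.1 j).le _)
    (Real.rpow_nonneg (sub_nonneg.2 this.le) _)

noncomputable def Acon (E α : ℝ) : ENNReal :=
  ∫⁻ u, ENNReal.ofReal (1 + (1 - u) ^ (-(2 * α)) + E ^ α * u ^ (-(2 * α))) ∂unif01

lemma Acon_ne_top (E α : ℝ) (hα2 : α < 1/2) : Acon E α ≠ ⊤ := by
  have h1 : IntervalIntegrable (fun u : ℝ => u ^ (-(2 * α))) volume 0 1 :=
    intervalIntegral.intervalIntegrable_rpow' (by linarith)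
  have h2 : IntervalIntegrable (fun u : ℝ => (1 - u) ^ (-(2 * α))) volume 0 1 := by
    simpa using (h1.comp_sub_left 1).symm
  have h3 : IntervalIntegrable (fun u : ℝ => 1 + (1 - u) ^ (-(2 * α)) + E ^ α * u ^ (-(2 * α)))
      volume 0 1 := (intervalIntegrable_const.add h2).add (h1.const_mul _)
  rw [intervalIntegrable_iff_integrableOn_Ioo_of_le zero_le_one] at h3
  exact (Integrable.lintegral_lt_top h3).ne

lemma ustep_le (m : ℕ) (E : ℝ) (hE : 0 < E) (α : ℝ) (hα1 : 1/4 < α) (x : Delta m E) :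
    ∫⁻ z, ENNReal.ofReal (Vfun m E α z) ∂(ustep m E x) ≤
      (1 + (ENNReal.ofReal (Lam m E))⁻¹ * (m * (ENNReal.ofReal (Real.sqrt E) * Acon E α))) *
        ENNReal.ofReal (Vfun m E α x) := by
  rw [ustep, lintegral_add_measure, lintegral_smul_measure, lintegral_smul_measure,
    lintegral_sum_measure, lintegral_dirac' _ (Vfun_meas m E α), tsum_fintype, add_mul]
  simp only [smul_eq_mul, lintegral_smul_measure]
  refine add_le_add (mul_le_mul_left ?_ _) ?_
  · apply ENNReal.ofReal_le_one.2
    have : 0 ≤ jumpRate m E x / Lam m E :=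
      div_nonneg (Finset.sum_nonneg fun i _ => Real.sqrt_nonneg _) (Real.sqrt_nonneg _)
    linarith
  · rw [mul_assoc]
    gcongr
    have key : ∀ i : Fin m, ENNReal.ofReal (Real.sqrt (x.1 i)) *
        ∫⁻ z, ENNReal.ofReal (Vfun m E α z) ∂(Measure.map (fun u => Texch m E i u x) unif01) ≤
        ENNReal.ofReal (Real.sqrt E) * Acon E α * ENNReal.ofReal (Vfun m E α x) := by
      intro i
      rw [mul_assoc]
      have hlt : x.1 i < E := lt_of_le_of_lt
        (Finset.single_le_sum (f := x.1) (fun j _ => (x.2.1 j).le) (Finset.mem_univ i)) x.2.2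
      gcongr
      refine (lintegral_map_le _ _).trans ?_
      rw [Acon, ← lintegral_mul_const' _ _ ENNReal.ofReal_ne_top]
      apply setLIntegral_mono' measurableSet_Ioo
      intro u hu
      rw [← ENNReal.ofReal_mul']
      · exact ENNReal.ofReal_le_ofReal (Vfun_exch_le m E hE α hα1 x i u hu)
      · exact Vfun_nonneg m E α x
    calc _ ≤ ∑ i : Fin m, ENNReal.ofReal (Real.sqrt E) * Acon E α * ENNReal.ofReal (Vfun m E α x) :=
          Finset.sum_le_sum fun i _ => key i
      _ = _ := by simp [mul_assoc]

lemma iter_le (m : ℕ) (E α : ℝ) (c : ENNReal) (hc : c ≠ ⊤)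
    (H : ∀ x : Delta m E, ∫⁻ z, ENNReal.ofReal (Vfun m E α z) ∂(ustep m E x) ≤
      c * ENNReal.ofReal (Vfun m E α x)) (n : ℕ) : ∀ x : Delta m E,
    ∫⁻ z, ENNReal.ofReal (Vfun m E α z) ∂(ustepIter m E n x) ≤
      c ^ n * ENNReal.ofReal (Vfun m E α x) := by
  induction n with
  | zero =>
    intro x
    simp [ustepIter, lintegral_dirac' _ (Vfun_meas m E α)]
  | succ n ih =>
    intro x
    rw [ustepIter]
    by_cases hm : AEMeasurable (ustepIter m E n) (ustep m E x)
    · rw [Measure.lintegral_bind hm (Vfun_meas m E α).aemeasurable]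
      calc _ ≤ ∫⁻ z, c ^ n * ENNReal.ofReal (Vfun m E α z) ∂(ustep m E x) :=
            lintegral_mono fun z => ih z
        _ = c ^ n * ∫⁻ z, ENNReal.ofReal (Vfun m E α z) ∂(ustep m E x) :=
            lintegral_const_mul _ (Vfun_meas m E α)
        _ ≤ c ^ n * (c * ENNReal.ofReal (Vfun m E α x)) := by gcongr; exact H x
        _ = _ := by ring
    · have h0 : (ustep m E x).bind (ustepIter m E n) = 0 := by
        unfold Measure.bind
        rw [Measure.map_of_not_aemeasurable hm, Measure.join_zero]
      beta_reduce
      rw [h0]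
      simp

theorem PhV_bounded_off_boundary (m : ℕ) (hm : 1 ≤ m) (E : ℝ) (hE : 0 < E)
    (α : ℝ) (hα1 : 1/4 < α) (hα2 : α < 1/2) (ε₀ : ℝ) (hε₀ : 0 < ε₀) (h : ℝ) (hh : 0 < h) :
    ∃ C : ℝ, ∀ x : Delta m E, x ∉ Bset m E α ε₀ →
      ∫⁻ z, ENNReal.ofReal (Vfun m E α z) ∂(Pt m E h x) ≤ ENNReal.ofReal C := by
  have hLam : 0 < Lam m E := Real.sqrt_pos.2 (mul_pos (by exact_mod_cast hm) hE)
  obtain ⟨c, hc⟩ : ∃ c : ENNReal, c = 1 + (ENNReal.ofReal (Lam m E))⁻¹ *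
    (m * (ENNReal.ofReal (Real.sqrt E) * Acon E α)) := ⟨_, rfl⟩
  have hct : c ≠ ⊤ := by
    rw [hc]
    refine ENNReal.add_ne_top.2 ⟨ENNReal.one_ne_top, ENNReal.mul_ne_top ?_
      (ENNReal.mul_ne_top (ENNReal.natCast_ne_top m)
        (ENNReal.mul_ne_top ENNReal.ofReal_ne_top (Acon_ne_top E α hα2)))⟩
    exact ENNReal.inv_ne_top.2 (ENNReal.ofReal_pos.2 hLam).ne'
  have H := iter_le m E α c hct (fun x => by rw [hc]; exact ustep_le m E hE α hα1 x)
  obtain ⟨S, hS⟩ : ∃ S : ENNReal, S = ∑' n : ℕ, ENNReal.ofReal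
    (Real.exp (-(Lam m E) * h) * ((Lam m E) * h) ^ n / n.factorial) * c ^ n := ⟨_, rfl⟩
  have hSt : S ≠ ⊤ := by
    have e : ∀ n : ℕ, ENNReal.ofReal
      (Real.exp (-(Lam m E) * h) * ((Lam m E) * h) ^ n / n.factorial) * c ^ n =
      ENNReal.ofReal (Real.exp (-(Lam m E) * h) * ((Lam m E * h * c.toReal) ^ n / n.factorial)) := by
      intro n
      conv_lhs => rw [← ENNReal.ofReal_toReal hct]
      rw [← ENNReal.ofReal_pow ENNReal.toReal_nonneg, ← ENNReal.ofReal_mul (by positivity)]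
      congr 1
      rw [mul_pow]; ring
    rw [hS]
    simp_rw [e]
    exact ((Real.summable_pow_div_factorial _).mul_left _).tsum_ofReal_ne_top
  obtain ⟨δ, hδ⟩ : ∃ δ : ℝ, δ = (4:ℝ) ^ (-(1 / (2 * α))) * ε₀ := ⟨_, rfl⟩
  have hδ0 : 0 < δ := by rw [hδ]; positivity
  refine ⟨(S * ENNReal.ofReal (m * δ ^ (-(2 * α)) + ε₀ ^ (-α))).toReal, fun x hx => ?_⟩
  rw [ENNReal.ofReal_toReal (ENNReal.mul_ne_top hSt ENNReal.ofReal_ne_top)]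
  have hV : Vfun m E α x ≤ m * δ ^ (-(2 * α)) + ε₀ ^ (-α) := by
    simp only [Bset, mem_ofPred_eq, not_or, not_lt, not_exists, ← hδ] at hx
    obtain ⟨h1, h2⟩ := hx
    unfold Vfun
    refine add_le_add ?_ (Real.rpow_le_rpow_of_nonpos hε₀ h1 (by linarith))
    calc _ ≤ ∑ i : Fin m, δ ^ (-(2 * α)) := Finset.sum_le_sum fun i _ =>
          Real.rpow_le_rpow_of_nonpos hδ0 (h2 i) (by linarith)
      _ = _ := by simp
  rw [Pt, lintegral_sum_measure]
  simp only [lintegral_smul_measure, smul_eq_mul]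
  calc _ ≤ ∑' n : ℕ, ENNReal.ofReal
        (Real.exp (-(Lam m E) * h) * ((Lam m E) * h) ^ n / n.factorial) * c ^ n *
          ENNReal.ofReal (Vfun m E α x) := by
        refine ENNReal.tsum_le_tsum fun n => ?_
        rw [mul_assoc]
        gcongr
        exact H n x
    _ = S * ENNReal.ofReal (Vfun m E α x) := by rw [ENNReal.tsum_mul_right, hS]
    _ ≤ _ := by gcongr
end

section
/- Doeblin-type minorization on active states: for every t > 0 and every ε > 0 there exists a constant η = η(ε, t) > 0 such that for every x ∈ A_ε, P^t(x, ·) ≥ η · U_{A_ε}(·), where U_{A_ε} is the uniform probability measure on A_ε. -/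
open MeasureTheory Set Filter

/-- The set of active states `A_ε = {x ∈ Δ : x^i ≥ ε for all i, and y ≥ ε}`. -/
def activeSet (m : ℕ) (E : ℝ) (ε : ℝ) : Set (Delta m E) :=
  {x | (∀ i, ε ≤ x.1 i) ∧ ε ≤ tank m E x}

/-- The uniform (normalized Lebesgue) probability measure on a set `S ⊆ Δ`. -/
noncomputable def uniformOn (m : ℕ) (E : ℝ) (S : Set (Delta m E)) : Measure (Delta m E) :=
  (lebU m E S)⁻¹ • (lebU m E).restrict S

lemma hx_meas_Texch (m : ℕ) (E : ℝ) (i : Fin m) :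
    Measurable (fun p : Delta m E × ℝ => Texch m E i p.2 p.1) := by
  have h : Measurable (fun p : Delta m E × ℝ => (Texch m E i p.2 p.1).1) := by
    have h2 : (fun p : Delta m E × ℝ => (Texch m E i p.2 p.1).1) =
        fun p => if p.2 ∈ Ioo (0:ℝ) 1 then T0 m E i p.2 p.1.1 else p.1.1 := by
      funext p
      unfold Texch
      split_ifs <;> rfl
    rw [h2]
    refine Measurable.ite (measurable_snd measurableSet_Ioo) ?_
      (measurable_subtype_coe.comp measurable_fst)
    unfold T0
    have hc : Measurable (fun p : Delta m E × ℝ => p.1.1) :=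
      measurable_subtype_coe.comp measurable_fst
    have hcj : ∀ j, Measurable (fun p : Delta m E × ℝ => p.1.1 j) :=
      fun j => (measurable_pi_apply j).comp hc
    rw [measurable_pi_iff]
    intro j
    by_cases hj : j = i
    · subst hj
      simp only [Function.update_self]
      refine Measurable.add (measurable_const.sub (Finset.measurable_sum _ (fun j _ => hcj j))) ?_
      exact (measurable_const.sub (measurable_snd.pow_const 2)).mul (hcj j)
    · simp only [Function.update_of_ne hj]
      exact hcj j
  exact h.subtype_mk (h := fun p => (Texch m E i p.2 p.1).2)

instance : SFinite unif01 := by unfold unif01; infer_instance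

lemma hx_meas_Texch1 (m : ℕ) (E : ℝ) (i : Fin m) (x : Delta m E) :
    Measurable (fun u : ℝ => Texch m E i u x) :=
  (hx_meas_Texch m E i).comp (measurable_const.prodMk measurable_id)

lemma hx_meas_ustep (m : ℕ) (E : ℝ) : Measurable (ustep m E) := by
  have hcj : ∀ j, Measurable (fun x : Delta m E => x.1 j) :=
      fun j => (measurable_pi_apply j).comp measurable_subtype_coe
  refine Measure.measurable_of_measurable_coe _ (fun s hs => ?_)
  unfold ustep
  simp only [Measure.add_apply, Measure.smul_apply, smul_eq_mul]
  refine Measurable.add (Measurable.mul ?_ ?_) (Measurable.mul measurable_const ?_)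
  · unfold jumpRate
    exact ((measurable_const.sub
      ((Finset.measurable_sum _ (fun j _ => (hcj j).sqrt)).div_const _))).ennreal_ofReal
  · exact Measure.measurable_coe hs |>.comp Measure.measurable_dirac
  · simp only [Measure.sum_apply _ hs, Measure.smul_apply, smul_eq_mul]
    refine Measurable.tsum (fun i => Measurable.mul ((hcj i).sqrt).ennreal_ofReal ?_)
    have : ∀ x : Delta m E, Measure.map (fun u => Texch m E i u x) unif01 s
        = unif01 (Prod.mk x ⁻¹' ((fun p : Delta m E × ℝ => Texch m E i p.2 p.1) ⁻¹' s)) := by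
      intro x
      rw [Measure.map_apply (hx_meas_Texch1 m E i x) hs]
      rfl
    simp only [this]
    exact measurable_measure_prodMk_left (hx_meas_Texch m E i hs)

lemma hx_meas_iter (m : ℕ) (E : ℝ) (n : ℕ) : Measurable (ustepIter m E n) := by
  induction n with
  | zero => exact Measure.measurable_dirac
  | succ n ih => exact (Measure.measurable_bind' ih).comp (hx_meas_ustep m E)

open Classical in
/-- Expected value of `F` after `n` steps, extended by zero outside `U`. -/
noncomputable def hxV (m : ℕ) (E : ℝ) (F : (Fin m → ℝ) → ENNReal) (n : ℕ) (w : Fin m → ℝ) :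
    ENNReal :=
  if h : w ∈ simU m E then ∫⁻ z, F z.1 ∂ustepIter m E n ⟨w, h⟩ else 0

lemma hxV_eq (m : ℕ) (E : ℝ) (F : (Fin m → ℝ) → ENNReal) (n : ℕ) (w : Fin m → ℝ)
    (h : w ∈ simU m E) : hxV m E F n w = ∫⁻ z, F z.1 ∂ustepIter m E n ⟨w, h⟩ := by
  unfold hxV
  rw [dif_pos h]

lemma hxV_zero (m : ℕ) (E : ℝ) (F : (Fin m → ℝ) → ENNReal) (hF : Measurable F) (w : Fin m → ℝ)
    (h : w ∈ simU m E) : hxV m E F 0 w = F w := by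
  rw [hxV_eq _ _ _ _ _ h]
  simp only [ustepIter]
  exact lintegral_dirac' _ (hF.comp measurable_subtype_coe)

lemma hx_sum_update {m : ℕ} (x : Fin m → ℝ) (i : Fin m) (z : ℝ) :
    ∑ j, Function.update x i z j = ∑ j, x j - x i + z := by
  rw [Finset.sum_update_of_mem (Finset.mem_univ i), ← Finset.erase_eq,
    Finset.sum_erase_eq_sub (Finset.mem_univ i)]
  ring

lemma hx_update_mem {m : ℕ} {E : ℝ} {x : Fin m → ℝ} (hx : x ∈ simU m E) (i : Fin m) {z : ℝ}
    (hz : 0 < z) (hz2 : z < E - ∑ j, x j + x i) : Function.update x i z ∈ simU m E := by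
  refine ⟨fun j => ?_, ?_⟩
  · by_cases hj : j = i
    · subst hj; simpa using hz
    · simpa [Function.update_of_ne hj] using hx.1 j
  · rw [hx_sum_update]; linarith

lemma hx_le_E {m : ℕ} {E : ℝ} {x : Fin m → ℝ} (hx : x ∈ simU m E) (i : Fin m) : x i ≤ E :=
  (Finset.single_le_sum (fun j _ => (hx.1 j).le) (Finset.mem_univ i)).trans hx.2.le

lemma hx_cov (a b E : ℝ) (hb : 0 < b) (hbE : b ≤ E) (G : ℝ → ENNReal) :
    (ENNReal.ofReal (2 * E))⁻¹ * ∫⁻ z in Ioo a (a + b), G z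
      ≤ ∫⁻ u in Ioo (0:ℝ) 1, G (a + (1 - u ^ 2) * b) := by
  have hE : 0 < E := lt_of_lt_of_le hb hbE
  have himg : Ioo a (a + b) ⊆ (fun u : ℝ => a + (1 - u ^ 2) * b) '' Ioo (0:ℝ) 1 := by
    intro z hz
    have h1 : 0 < (a + b - z) / b := div_pos (by linarith [hz.2]) hb
    have h2 : (a + b - z) / b < 1 := by rw [div_lt_one hb]; linarith [hz.1]
    refine ⟨Real.sqrt ((a + b - z) / b), ⟨Real.sqrt_pos.2 h1, ?_⟩, ?_⟩
    · rw [Real.sqrt_lt' one_pos]; simpa using h2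
    · simp only
      rw [Real.sq_sqrt h1.le]
      field_simp
      ring
  have hd : ∀ u ∈ Ioo (0:ℝ) 1, HasDerivWithinAt (fun u : ℝ => a + (1 - u ^ 2) * b)
      (-(2 * u) * b) (Ioo (0:ℝ) 1) u := by
    intro u _
    have := ((((hasDerivAt_id u).pow 2).const_sub 1).mul_const b).const_add a
    refine HasDerivAt.hasDerivWithinAt ?_
    convert this using 1
    · funext v; simp
    · simp
  have hinj : InjOn (fun u : ℝ => a + (1 - u ^ 2) * b) (Ioo (0:ℝ) 1) := by
    intro u hu v hv huv
    simp only at huv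
    have h1 : (v ^ 2 - u ^ 2) * b = 0 := by linarith
    have h2 : u ^ 2 = v ^ 2 := by
      rcases mul_eq_zero.1 h1 with h | h
      · linarith
      · exact absurd h hb.ne'
    exact (pow_left_inj₀ hu.1.le hv.1.le two_ne_zero).1 h2
  have key := lintegral_image_eq_lintegral_abs_deriv_mul measurableSet_Ioo hd hinj G
  have hne : ENNReal.ofReal (2 * E) ≠ 0 := by
    rw [Ne, ENNReal.ofReal_eq_zero]; linarith
  calc (ENNReal.ofReal (2 * E))⁻¹ * ∫⁻ z in Ioo a (a + b), G z
      ≤ (ENNReal.ofReal (2 * E))⁻¹ * ∫⁻ z in (fun u : ℝ => a + (1 - u ^ 2) * b) '' Ioo (0:ℝ) 1, G z := by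
        gcongr
    _ = (ENNReal.ofReal (2 * E))⁻¹ * ∫⁻ u in Ioo (0:ℝ) 1,
          ENNReal.ofReal |-(2 * u) * b| * G (a + (1 - u ^ 2) * b) := by rw [key]
    _ ≤ ∫⁻ u in Ioo (0:ℝ) 1, (ENNReal.ofReal (2 * E))⁻¹ *
          (ENNReal.ofReal |-(2 * u) * b| * G (a + (1 - u ^ 2) * b)) := lintegral_const_mul_le _ _
    _ ≤ ∫⁻ u in Ioo (0:ℝ) 1, G (a + (1 - u ^ 2) * b) := by
        refine setLIntegral_mono' measurableSet_Ioo (fun u hu => ?_)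
        have h3 : |-(2 * u) * b| ≤ 2 * E := by
          rw [abs_mul, abs_neg, abs_of_pos (by linarith [hu.1]), abs_of_pos hb]
          nlinarith [hu.1, hu.2]
        calc (ENNReal.ofReal (2 * E))⁻¹ * (ENNReal.ofReal |-(2 * u) * b| * G (a + (1 - u ^ 2) * b))
            ≤ (ENNReal.ofReal (2 * E))⁻¹ * (ENNReal.ofReal (2 * E) * G (a + (1 - u ^ 2) * b)) := by
              gcongr
          _ = G (a + (1 - u ^ 2) * b) := by
              rw [← mul_assoc, ENNReal.inv_mul_cancel hne ENNReal.ofReal_ne_top, one_mul]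

/-- One step lower bound. -/
lemma hx_one {m : ℕ} {E : ℝ} {F : (Fin m → ℝ) → ENNReal} (hF : Measurable F) (n : ℕ)
    {x : Fin m → ℝ} (hx : x ∈ simU m E) (i : Fin m) :
    (ENNReal.ofReal (Lam m E))⁻¹ * (ENNReal.ofReal (Real.sqrt (x i)) *
      ((ENNReal.ofReal (2 * E))⁻¹ *
        ∫⁻ z in Ioo (E - ∑ j, x j) (E - ∑ j, x j + x i), hxV m E F n (Function.update x i z)))
      ≤ hxV m E F (n + 1) x := by
  have hg : Measurable (fun z : Delta m E => ∫⁻ w, F w.1 ∂ustepIter m E n z) :=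
    (Measure.measurable_lintegral (hF.comp measurable_subtype_coe)).comp (hx_meas_iter m E n)
  rw [hxV_eq _ _ _ _ _ hx]
  simp only [ustepIter]
  have hb := Measure.lintegral_bind (m := ustep m E ⟨x, hx⟩) (hx_meas_iter m E n).aemeasurable
    (f := fun z : Delta m E => F z.1) (hF.comp measurable_subtype_coe).aemeasurable
  rw [hb]
  unfold ustep
  rw [lintegral_add_measure, lintegral_smul_measure, lintegral_smul_measure,
    lintegral_sum_measure]
  refine le_trans ?_ le_add_self
  simp only [smul_eq_mul]
  gcongr
  refine le_trans ?_ (ENNReal.le_tsum i)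
  rw [lintegral_smul_measure, smul_eq_mul, lintegral_map hg (hx_meas_Texch1 m E i _)]
  gcongr
  refine (hx_cov _ _ E (hx.1 i) (hx_le_E hx i) _).trans ?_
  unfold unif01
  refine setLIntegral_mono' measurableSet_Ioo (fun u hu => ?_)
  have h1 : Texch m E i u ⟨x, hx⟩ = ⟨T0 m E i u x, T0_mem hx hu⟩ := by
    unfold Texch; rw [dif_pos hu]
  rw [h1, ← hxV_eq]
  exact le_rfl

/-- The constant in the two step bound. -/
noncomputable def hxc (m : ℕ) (E δ : ℝ) : ENNReal :=
  (ENNReal.ofReal (Lam m E))⁻¹ * (ENNReal.ofReal (Real.sqrt δ) * (ENNReal.ofReal (2 * E))⁻¹)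

noncomputable def hxd (m : ℕ) (E δ : ℝ) : ENNReal :=
  hxc m E δ * hxc m E δ * ENNReal.ofReal δ

lemma hx_one' {m : ℕ} {E : ℝ} {F : (Fin m → ℝ) → ENNReal} (hF : Measurable F) (n : ℕ)
    {x : Fin m → ℝ} (hx : x ∈ simU m E) (i : Fin m) {δ : ℝ} (h : δ ≤ x i) :
    hxc m E δ * ∫⁻ z in Ioo (E - ∑ j, x j) (E - ∑ j, x j + x i),
        hxV m E F n (Function.update x i z) ≤ hxV m E F (n + 1) x := by
  refine le_trans ?_ (hx_one hF n hx i)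
  unfold hxc
  rw [mul_assoc, mul_assoc]
  gcongr

/-- Two step lower bound. -/
lemma hx_two {m : ℕ} {E : ℝ} {F : (Fin m → ℝ) → ENNReal} (hF : Measurable F) (n : ℕ)
    {x : Fin m → ℝ} (hx : x ∈ simU m E) (i : Fin m) {δ : ℝ} (hδ : 0 < δ) (h : 2 * δ ≤ x i) :
    hxd m E δ * ∫⁻ z in Ioo δ (E - ∑ j, x j + x i),
        hxV m E F n (Function.update x i z) ≤ hxV m E F (n + 2) x := by
  set y := E - ∑ j, x j with hy
  have hy0 : 0 < y := sub_pos.2 hx.2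
  refine le_trans ?_ (hx_one' hF (n + 1) hx i (δ := δ) (by linarith))
  unfold hxd
  rw [mul_assoc, mul_assoc]
  gcongr
  rw [← hy]
  set I := ∫⁻ z in Ioo δ (y + x i), hxV m E F n (Function.update x i z) with hI
  calc hxc m E δ * (ENNReal.ofReal δ * I)
      = ∫⁻ z in Ioo (y + x i - δ) (y + x i), hxc m E δ * I := by
        rw [setLIntegral_const, Real.volume_Ioo]
        have : y + x i - (y + x i - δ) = δ := by ring
        rw [this]; ring
    _ ≤ ∫⁻ z in Ioo (y + x i - δ) (y + x i), hxV m E F (n + 1) (Function.update x i z) := by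
        refine setLIntegral_mono' measurableSet_Ioo (fun z hz => ?_)
        have hzU : Function.update x i z ∈ simU m E :=
          hx_update_mem hx i (by linarith [hz.1]) hz.2
        refine le_trans ?_ (hx_one' hF n hzU i (δ := δ)
          (by rw [Function.update_self]; linarith [hz.1]))
        gcongr
        rw [hI, hx_sum_update, Function.update_self]
        simp only [Function.update_idem]
        refine lintegral_mono_set (Ioo_subset_Ioo ?_ ?_) <;> linarith [hz.1, hz.2]
    _ ≤ _ := lintegral_mono_set (Ioo_subset_Ioo (by linarith) le_rfl)

/-- Filling phase. -/
lemma hx_fill {m : ℕ} {E : ℝ} {F : (Fin m → ℝ) → ENNReal} (hF : Measurable F) {δ ε : ℝ}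
    (hδ : 0 < δ) (hδε : δ < ε) (hm : 3 * m * δ < ε)
    (hsupp : ∀ w, F w ≠ 0 → (∀ i, ε ≤ w i) ∧ ∑ i, w i ≤ E - ε) (S : Finset (Fin m)) :
    ∀ x ∈ simU m E, (∀ j ∈ S, 2 * δ ≤ x j ∧ x j ≤ 3 * δ) →
      hxd m E δ ^ S.card * lmarginal (fun _ => volume) S F x ≤ hxV m E F (2 * S.card) x := by
  induction S using Finset.induction_on with
  | empty =>
    intro x hx _
    simp [hxV_zero m E F hF x hx]
  | insert i S hi ih =>
    intro x hx hS
    have hxi := hS i (Finset.mem_insert_self i S)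
    rw [lmarginal_insert _ hF hi, Finset.card_insert_of_notMem hi]
    refine le_trans ?_ (hx_two hF (2 * S.card) hx i hδ hxi.1)
    rw [pow_succ, mul_comm (hxd m E δ ^ S.card), mul_assoc]
    gcongr
    have hres : ∫⁻ z, lmarginal (fun _ => volume) S F (Function.update x i z)
        = ∫⁻ z in Ioo δ (E - ∑ j, x j + x i),
          lmarginal (fun _ => volume) S F (Function.update x i z) := by
      symm
      apply setLIntegral_eq_of_support_subset
      intro z hz
      by_contra hcon
      apply hz
      unfold lmarginal
      rw [lintegral_eq_zero_iff' (by fun_prop)]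
      refine Eventually.of_forall (fun w => ?_)
      by_contra hne
      obtain ⟨h1, h2⟩ := hsupp _ hne
      have hvi : Function.updateFinset (Function.update x i z) S w i = z := by
        simp [Function.updateFinset, hi]
      have hz1 : ε ≤ z := hvi ▸ h1 i
      have hz2 : E - ∑ j, x j + x i ≤ z := by
        by_contra hlt
        exact hcon ⟨by linarith, not_le.1 hlt⟩
      have hle : ∑ j, (Function.update x i z j - 3 * δ)
          ≤ ∑ j, Function.updateFinset (Function.update x i z) S w j := by
        refine Finset.sum_le_sum (fun j _ => ?_)
        by_cases hj : j ∈ S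
        · have hji : j ≠ i := fun h => hi (h ▸ hj)
          have hj2 := (hS j (Finset.mem_insert_of_mem hj)).2
          have hj3 := h1 j
          rw [Function.update_of_ne hji]
          linarith
        · have : Function.updateFinset (Function.update x i z) S w j
              = Function.update x i z j := by
            simp [Function.updateFinset, hj]
          rw [this]
          linarith
      rw [Finset.sum_sub_distrib, hx_sum_update, Finset.sum_const, Finset.card_univ,
        Fintype.card_fin, nsmul_eq_mul] at hle
      linarith
    rw [hres]
    refine (lintegral_const_mul_le _ _).trans ?_
    refine setLIntegral_mono' measurableSet_Ioo (fun z hz => ?_)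
    refine ih _ (hx_update_mem hx i (hδ.trans hz.1) hz.2) (fun j hj => ?_)
    have hji : j ≠ i := fun h => hi (h ▸ hj)
    rw [Function.update_of_ne hji]
    exact hS j (Finset.mem_insert_of_mem hj)

/-- Lowering phase. -/
lemma hx_lower {m : ℕ} {E : ℝ} {F : (Fin m → ℝ) → ENNReal} (hF : Measurable F) {δ ε : ℝ}
    (hδ : 0 < δ) (hδε : δ < ε) (hm : 3 * m * δ < ε)
    (hsupp : ∀ w, F w ≠ 0 → (∀ i, ε ≤ w i) ∧ ∑ i, w i ≤ E - ε) (S : Finset (Fin m)) :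
    ∀ x ∈ simU m E, (∀ j ∈ S, 3 * δ ≤ x j) → (∀ j ∉ S, 2 * δ ≤ x j ∧ x j ≤ 3 * δ) →
      (hxd m E δ * ENNReal.ofReal δ) ^ S.card * (hxd m E δ ^ m * ∫⁻ w, F w)
        ≤ hxV m E F (2 * m + 2 * S.card) x := by
  induction S using Finset.induction_on with
  | empty =>
    intro x hx _ h
    have := hx_fill hF hδ hδε hm hsupp Finset.univ x hx (fun j _ => h j (by simp))
    rw [lmarginal_univ, Finset.card_univ, Fintype.card_fin] at this
    rw [← volume_pi] at this
    simpa using this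
  | insert i S hi ih =>
    intro x hx hS hS'
    have hxi := hS i (Finset.mem_insert_self i S)
    have hy0 : 0 < E - ∑ j, x j := sub_pos.2 hx.2
    rw [Finset.card_insert_of_notMem hi]
    refine le_trans ?_ (hx_two hF (2 * m + 2 * S.card) hx i hδ (by linarith))
    rw [pow_succ, mul_comm (_ ^ S.card), mul_assoc, mul_assoc]
    gcongr
    calc ENNReal.ofReal δ * ((hxd m E δ * ENNReal.ofReal δ) ^ S.card *
            (hxd m E δ ^ m * ∫⁻ w, F w))
        = ∫⁻ z in Ioo (2 * δ) (3 * δ), (hxd m E δ * ENNReal.ofReal δ) ^ S.card *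
            (hxd m E δ ^ m * ∫⁻ w, F w) := by
          rw [setLIntegral_const, Real.volume_Ioo]
          have : 3 * δ - 2 * δ = δ := by ring
          rw [this]; ring
      _ ≤ ∫⁻ z in Ioo (2 * δ) (3 * δ), hxV m E F (2 * m + 2 * S.card) (Function.update x i z) := by
          refine setLIntegral_mono' measurableSet_Ioo (fun z hz => ?_)
          refine ih _ (hx_update_mem hx i (by linarith [hz.1]) (by linarith [hz.2]))
            (fun j hj => ?_) (fun j hj => ?_)
          · have hji : j ≠ i := fun h => hi (h ▸ hj)
            rw [Function.update_of_ne hji]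
            exact hS j (Finset.mem_insert_of_mem hj)
          · by_cases hji : j = i
            · subst hji
              rw [Function.update_self]
              exact ⟨hz.1.le, hz.2.le⟩
            · rw [Function.update_of_ne hji]
              exact hS' j (by simp [hji, hj])
      _ ≤ _ := lintegral_mono_set (Ioo_subset_Ioo (by linarith) (by linarith))

lemma hx_meas_simU (m : ℕ) (E : ℝ) : MeasurableSet (simU m E) := by
  have h : simU m E = (⋂ i, {x : Fin m → ℝ | 0 < x i}) ∩ {x | ∑ i, x i < E} := by
    ext x; simp [simU]
  rw [h]
  refine MeasurableSet.inter ?_ ?_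
  · exact MeasurableSet.iInter (fun i => measurableSet_lt measurable_const (measurable_pi_apply i))
  · exact measurableSet_lt (Finset.measurable_sum _ (fun j _ => measurable_pi_apply j))
      measurable_const

lemma hx_meas_active (m : ℕ) (E ε : ℝ) : MeasurableSet (activeSet m E ε) := by
  have hcj : ∀ j, Measurable (fun x : Delta m E => x.1 j) :=
      fun j => (measurable_pi_apply j).comp measurable_subtype_coe
  have h : activeSet m E ε = (⋂ i, {x : Delta m E | ε ≤ x.1 i}) ∩
      {x | ε ≤ E - ∑ i, x.1 i} := by
    ext x; simp [activeSet, tank]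
  rw [h]
  refine MeasurableSet.inter ?_ ?_
  · exact MeasurableSet.iInter (fun i => measurableSet_le measurable_const (hcj i))
  · exact measurableSet_le measurable_const
      (measurable_const.sub (Finset.measurable_sum _ (fun j _ => hcj j)))

lemma hxd_ne_zero {m : ℕ} {E δ : ℝ} (hδ : 0 < δ) : hxd m E δ ≠ 0 := by
  have h1 : ENNReal.ofReal δ ≠ 0 := by simpa using hδ
  have h2 : ENNReal.ofReal (Real.sqrt δ) ≠ 0 := by simpa using hδ
  have : hxc m E δ ≠ 0 := by
    unfold hxc
    exact mul_ne_zero (ENNReal.inv_ne_zero.2 ENNReal.ofReal_ne_top)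
      (mul_ne_zero h2 (ENNReal.inv_ne_zero.2 ENNReal.ofReal_ne_top))
  exact mul_ne_zero (mul_ne_zero this this) h1

lemma hx_main (m : ℕ) (hm : 1 ≤ m) (E : ℝ) (ε : ℝ) (hε : 0 < ε) :
    ∃ C : ENNReal, C ≠ 0 ∧ ∀ x ∈ activeSet m E ε, ∀ B, MeasurableSet B →
      C * lebU m E (B ∩ activeSet m E ε) ≤ ustepIter m E (4 * m) x B := by
  have hm' : (1:ℝ) ≤ m := by exact_mod_cast hm
  set δ : ℝ := ε / (4 * m) with hδd
  have hδm : 4 * (m * δ) = ε := by rw [hδd]; field_simp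
  have hδ : 0 < δ := by positivity
  have hδ' : δ ≤ m * δ := by nlinarith
  refine ⟨(hxd m E δ * ENNReal.ofReal δ) ^ m * hxd m E δ ^ m, ?_, ?_⟩
  · have h1 : ENNReal.ofReal δ ≠ 0 := by simpa using hδ
    exact mul_ne_zero (pow_ne_zero _ (mul_ne_zero (hxd_ne_zero hδ) h1))
      (pow_ne_zero _ (hxd_ne_zero hδ))
  intro x hx B hB
  have hBA := hB.inter (hx_meas_active m E ε)
  set W : Set (Fin m → ℝ) := Subtype.val '' (B ∩ activeSet m E ε) with hW
  have hWm : MeasurableSet W := (hx_meas_simU m E).subtype_image hBA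
  have hF : Measurable (W.indicator (fun _ => (1 : ENNReal))) := measurable_const.indicator hWm
  have key := hx_lower (E := E) hF hδ (ε := ε) (by linarith) (by linarith) (by
    intro w hw
    have hwW : w ∈ W := by
      by_contra h
      exact hw (indicator_of_notMem h _)
    obtain ⟨z, hz, rfl⟩ := hwW
    refine ⟨hz.2.1, ?_⟩
    have := hz.2.2
    unfold tank at this
    linarith) Finset.univ x.1 x.2 (fun j _ => by linarith [hx.1 j]) (by simp)
  rw [Finset.card_univ, Fintype.card_fin, lintegral_indicator_const hWm, one_mul,
    hxV_eq _ _ _ _ _ x.2, ← mul_assoc] at key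
  have h4 : 2 * m + 2 * m = 4 * m := by ring
  rw [h4] at key
  unfold lebU
  rw [Measure.comap_apply _ Subtype.val_injective
    (fun s hs => (hx_meas_simU m E).subtype_image hs) _ hBA]
  refine key.trans ?_
  have : ∀ z : Delta m E, W.indicator (fun _ => (1 : ENNReal)) z.1
      = (B ∩ activeSet m E ε).indicator (fun _ => 1) z := by
    intro z
    have hz : z.1 ∈ W ↔ z ∈ B ∩ activeSet m E ε := by
      rw [hW, Subtype.val_injective.mem_set_image]
    by_cases hz' : z ∈ B ∩ activeSet m E ε
    · rw [indicator_of_mem hz', indicator_of_mem (hz.2 hz')]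
    · rw [indicator_of_notMem hz', indicator_of_notMem (fun hh => hz' (hz.1 hh))]
  simp only [this]
  rw [lintegral_indicator_const hBA, one_mul]
  exact measure_mono inter_subset_left

/-- Proposition 3.1, Doeblin-type minorization on active states.
For every `t > 0` and `ε > 0` there is `η = η(ε,t) > 0` such that
`P^t(x, ·) ≥ η U_{A_ε}(·)` for every `x ∈ A_ε`. -/
theorem doeblin_minorization (m : ℕ) (hm : 1 ≤ m) (E : ℝ) (hE : 0 < E)
    (t : ℝ) (ht : 0 < t) (ε : ℝ) (hε : 0 < ε) :
    ∃ η > (0:ℝ), ∀ x ∈ activeSet m E ε,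
      ENNReal.ofReal η • uniformOn m E (activeSet m E ε) ≤ Pt m E t x := by
  obtain ⟨C, hC, h⟩ := hx_main m hm E ε hε
  set A := activeSet m E ε with hA
  set w : ℝ := Real.exp (-(Lam m E) * t) * ((Lam m E) * t) ^ (4 * m) / (4 * m).factorial with hw
  have hL : 0 < Lam m E := by
    unfold Lam
    have : (0:ℝ) < m := by exact_mod_cast hm
    positivity
  have hw0 : 0 < w := by positivity
  have hP : ∀ x ∈ A, ∀ B, MeasurableSet B →
      ENNReal.ofReal w * C * lebU m E (B ∩ A) ≤ Pt m E t x B := by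
    intro x hx B hB
    unfold Pt
    rw [Measure.sum_apply _ hB]
    refine le_trans ?_ (ENNReal.le_tsum (4 * m))
    rw [Measure.smul_apply, smul_eq_mul, mul_assoc]
    gcongr
    exact h x hx B hB
  by_cases h0 : lebU m E A = 0
  · refine ⟨1, one_pos, fun x hx => ?_⟩
    unfold uniformOn
    rw [Measure.restrict_eq_zero.2 h0]
    simp only [smul_zero]
    exact Measure.zero_le _
  have hpos : min 1 (ENNReal.ofReal w * C * lebU m E A) ≠ 0 := by
    have hw1 : ENNReal.ofReal w ≠ 0 := by simpa using hw0
    have := mul_ne_zero (mul_ne_zero hw1 hC) h0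
    intro hh
    rcases min_choice 1 (ENNReal.ofReal w * C * lebU m E A) with h1 | h1
    · rw [h1] at hh; exact one_ne_zero hh
    · rw [h1] at hh; exact this hh
  have hfin : min 1 (ENNReal.ofReal w * C * lebU m E A) ≠ ⊤ :=
    ne_top_of_le_ne_top ENNReal.one_ne_top (min_le_left _ _)
  refine ⟨(min 1 (ENNReal.ofReal w * C * lebU m E A)).toReal,
    ENNReal.toReal_pos hpos hfin, fun x hx => ?_⟩
  rw [ENNReal.ofReal_toReal hfin, Measure.le_iff]
  intro B hB
  refine le_trans ?_ (hP x hx B hB)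
  unfold uniformOn
  rw [Measure.smul_apply, Measure.smul_apply, smul_eq_mul, smul_eq_mul,
    Measure.restrict_apply hB, ← mul_assoc]
  refine mul_le_mul_left ?_ _
  rw [← div_eq_mul_inv]
  exact ENNReal.div_le_of_le_mul (min_le_right _ _)
end
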